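/- arXiv:2502.03620 — 7 statements merged into one kernel-verified Lean document; each statement's English description precedes it below -/
import Mathlib

section
/- There exists a universal constant C > 1 such that: for every nonempty countable set X, every hypothesis class H of functions X → {−1,1} with VC-dimension d ≥ 1, every number of voters t ∈ ℕ, every integer m ≥ d, every probability distribution D on X × {−1,1}, every margin 0 < γ < 1, every ξ > 1, and every 0 < δ < 1, with probability at least 1−δ over an i.i.d. sample S ~ D^m, every f ∈ Δ^t(H) satisfies P_{(x,y)~D}[ y·f(x) ≤ γ ] ≤ (1/m)·#{(x,y) ∈ S : y·f(x) ≤ ξ·γ} + C·√(2d/(((ξ−1)·γ)²·m)) + √(2·ln(2/δ)/m). -/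
open MeasureTheory Classical

noncomputable section

/-- H is a class of ±1-valued classifiers. -/
def IsHypClass {X : Type*} (H : Set (X → ℝ)) : Prop :=
  ∀ h ∈ H, ∀ x, h x = 1 ∨ h x = -1

def Shatters {X : Type*} (H : Set (X → ℝ)) {n : ℕ} (x : Fin n → X) : Prop :=
  ∀ y : Fin n → ℝ, (∀ i, y i = 1 ∨ y i = -1) → ∃ h ∈ H, ∀ i, h (x i) = y i

/-- H has VC-dimension d. -/
def VCDim {X : Type*} (H : Set (X → ℝ)) (d : ℕ) : Prop :=
  (∃ x : Fin d → X, Shatters H x) ∧ ¬ ∃ x : Fin (d + 1) → X, Shatters H x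

/-- Δ^t(H): averages of t hypotheses from H. -/
def DeltaT {X : Type*} (H : Set (X → ℝ)) (t : ℕ) : Set (X → ℝ) :=
  {f | ∃ hs : Fin t → (X → ℝ), (∀ i, hs i ∈ H) ∧ f = fun x => (∑ i, hs i x) / (t : ℝ)}


def rE : (n : ℕ) → ((Fin n → ℝ) → ℝ) → ℝ
  | 0, F => F Fin.elim0
  | n + 1, F => (rE n (fun s => F (Fin.cons 1 s)) + rE n (fun s => F (Fin.cons (-1) s))) / 2

def IsSgn {n : ℕ} (s : Fin n → ℝ) : Prop := ∀ i, s i = 1 ∨ s i = -1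

lemma IsSgn.cons1 {n : ℕ} {s : Fin n → ℝ} (h : IsSgn s) :
    IsSgn (Fin.cons 1 s : Fin (n+1) → ℝ) := by
  intro i; refine Fin.cases ?_ ?_ i
  · left; simp
  · intro j; simpa using h j

lemma IsSgn.consm1 {n : ℕ} {s : Fin n → ℝ} (h : IsSgn s) :
    IsSgn (Fin.cons (-1) s : Fin (n+1) → ℝ) := by
  intro i; refine Fin.cases ?_ ?_ i
  · right; simp
  · intro j; simpa using h j

lemma rE_mono : ∀ {n : ℕ} {F G : (Fin n → ℝ) → ℝ}, (∀ s, IsSgn s → F s ≤ G s) → rE n F ≤ rE n G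
  | 0, F, G, h => h _ (fun i => i.elim0)
  | n + 1, F, G, h => by
    have h1 := rE_mono (n := n) (F := fun s => F (Fin.cons 1 s)) (G := fun s => G (Fin.cons 1 s))
      (fun s hs => h _ hs.cons1)
    have h2 := rE_mono (n := n) (F := fun s => F (Fin.cons (-1) s))
      (G := fun s => G (Fin.cons (-1) s)) (fun s hs => h _ hs.consm1)
    simp only [rE]; linarith

lemma rE_congr {n : ℕ} {F G : (Fin n → ℝ) → ℝ} (h : ∀ s, IsSgn s → F s = G s) :
    rE n F = rE n G :=
  le_antisymm (rE_mono fun s hs => (h s hs).le) (rE_mono fun s hs => (h s hs).ge)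

lemma rE_add : ∀ {n : ℕ} (F G : (Fin n → ℝ) → ℝ), rE n (fun s => F s + G s) = rE n F + rE n G
  | 0, F, G => rfl
  | n + 1, F, G => by
    simp only [rE]; rw [rE_add, rE_add]; ring

lemma rE_mul : ∀ {n : ℕ} (c : ℝ) (F : (Fin n → ℝ) → ℝ), rE n (fun s => c * F s) = c * rE n F
  | 0, c, F => rfl
  | n + 1, c, F => by
    simp only [rE]; rw [rE_mul, rE_mul]; ring

lemma rE_const : ∀ (n : ℕ) (c : ℝ), rE n (fun _ => c) = c
  | 0, c => rfl
  | n + 1, c => by simp only [rE]; rw [rE_const]; ring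

lemma rE_sum {n : ℕ} {κ : Type*} (t : Finset κ) (F : κ → (Fin n → ℝ) → ℝ) :
    rE n (fun s => ∑ k ∈ t, F k s) = ∑ k ∈ t, rE n (F k) := by
  induction t using Finset.induction_on with
  | empty => simp [rE_const]
  | insert a t ha ih => simp only [Finset.sum_insert ha]; rw [rE_add, ih]

lemma neg_cons {n : ℕ} (a : ℝ) (s : Fin n → ℝ) :
    (-(Fin.cons a s : Fin (n+1) → ℝ)) = Fin.cons (-a) (-s) := by
  funext i; refine Fin.cases ?_ ?_ i <;> simp

lemma rE_neg : ∀ {n : ℕ} (F : (Fin n → ℝ) → ℝ), rE n (fun s => F (-s)) = rE n F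
  | 0, F => by simp only [rE]; congr 1; funext i; exact i.elim0
  | n + 1, F => by
    simp only [rE, neg_cons, neg_neg]
    rw [rE_neg (fun s => F (Fin.cons (-1) s)), rE_neg (fun s => F (Fin.cons 1 s))]; ring

lemma rE_lin {n : ℕ} (a : Fin n → ℝ) : rE n (fun s => ∑ i, s i * a i) = 0 := by
  have h := rE_neg (fun s => ∑ i, s i * a i)
  have h2 := rE_mul (-1) (fun s : Fin n → ℝ => ∑ i, s i * a i)
  have : (fun s : Fin n → ℝ => ∑ i, (-s) i * a i) = fun s => -1 * ∑ i, s i * a i := by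
    funext s; simp
  rw [this] at h; linarith

lemma half_exp (a b : ℝ) : (Real.exp a + Real.exp b) / 2 ≤
    Real.exp ((a + b) / 2 + ((a - b) / 2) ^ 2 / 2) := by
  have h := Real.cosh_le_exp_half_sq ((a - b) / 2)
  have e : (Real.exp a + Real.exp b) / 2 = Real.exp ((a + b) / 2) * Real.cosh ((a - b) / 2) := by
    rw [Real.cosh_eq, mul_div_assoc', mul_add, ← Real.exp_add, ← Real.exp_add]
    ring_nf
  rw [e, Real.exp_add]
  gcongr

/-- McDiarmid on the cube -/
lemma rE_mcd (lam : ℝ) : ∀ {n : ℕ} (F : (Fin n → ℝ) → ℝ),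
    (∀ s s', |F s - F s'| ≤ ∑ i, |s i - s' i|) →
    rE n (fun s => Real.exp (lam * F s)) ≤ Real.exp (lam * rE n F + n * lam ^ 2 / 2)
  | 0, F, h => by simp [rE]
  | n + 1, F, h => by
    have lip : ∀ a : ℝ, ∀ s s' : Fin n → ℝ,
        |F (Fin.cons a s) - F (Fin.cons a s')| ≤ ∑ i, |s i - s' i| := by
      intro a s s'
      have := h (Fin.cons a s) (Fin.cons a s')
      simpa [Fin.sum_univ_succ] using this
    have h1 := rE_mcd lam (fun s => F (Fin.cons 1 s)) (lip 1)
    have h2 := rE_mcd lam (fun s => F (Fin.cons (-1) s)) (lip (-1))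
    simp only [rE]
    set A := rE n (fun s => F (Fin.cons 1 s))
    set B := rE n (fun s => F (Fin.cons (-1) s))
    have d : ∀ s, |F (Fin.cons 1 s) - F (Fin.cons (-1) s)| ≤ 2 := by
      intro s
      have := h (Fin.cons 1 s) (Fin.cons (-1) s)
      simp [Fin.sum_univ_succ] at this
      refine this.trans ?_
      norm_num
    have hAB : |A - B| ≤ 2 := by
      rw [abs_le]
      have e1 : A ≤ B + 2 := by
        rw [← rE_const n 2, ← rE_add]
        exact rE_mono fun s _ => by have := abs_le.1 (d s); linarith
      have e2 : B ≤ A + 2 := by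
        rw [← rE_const n 2, ← rE_add]
        exact rE_mono fun s _ => by have := abs_le.1 (d s); linarith
      constructor <;> linarith
    have h3 := half_exp (lam * A + n * lam ^ 2 / 2) (lam * B + n * lam ^ 2 / 2)
    refine le_trans (by linarith) (h3.trans (Real.exp_le_exp.2 ?_))
    have : (A - B) ^ 2 ≤ 4 := by
      have := sq_abs (A - B); nlinarith [abs_nonneg (A - B)]
    push_cast
    nlinarith [mul_le_mul_of_nonneg_left this (sq_nonneg lam)]

lemma rE_exp_lin : ∀ {n : ℕ} (a : Fin n → ℝ),
    rE n (fun s => Real.exp (∑ i, s i * a i)) ≤ Real.exp ((∑ i, a i ^ 2) / 2)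
  | 0, a => by simp [rE]
  | n + 1, a => by
    have h := rE_exp_lin (fun i : Fin n => a i.succ)
    simp only [rE, Fin.sum_univ_succ, Fin.cons_zero, Fin.cons_succ, Real.exp_add, rE_mul]
    have h3 := half_exp (1 * a 0) (-1 * a 0)
    rw [← add_mul, mul_div_right_comm, add_div (a 0 ^ 2), Real.exp_add]
    refine mul_le_mul (h3.trans (Real.exp_le_exp.2 ?_)) h ?_ (Real.exp_pos _).le
    · nlinarith
    · rw [← rE_const n 0]; exact rE_mono fun s _ => (Real.exp_pos _).le

/-- Massart -/
lemma massart {n : ℕ} {κ : Type*} (t : Finset κ) (ht : t.Nonempty) (a : κ → Fin n → ℝ) (q lam : ℝ)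
    (hlam : 0 < lam) (hq : ∀ k ∈ t, ∑ i, a k i ^ 2 ≤ q) (M : (Fin n → ℝ) → ℝ)
    (hM : ∀ s, ∃ k ∈ t, M s ≤ ∑ i, s i * a k i) :
    rE n M ≤ Real.log t.card / lam + lam * q / 2 := by
  set c := Real.log t.card + lam ^ 2 * q / 2 with hc
  have key : rE n (fun s => lam * M s) ≤ rE n (fun s => (c - 1) +
      ∑ k ∈ t, Real.exp (-c) * Real.exp (∑ i, s i * (lam * a k i))) := by
    refine rE_mono fun s _ => ?_
    obtain ⟨k, hk, hk2⟩ := hM s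
    have h1 : Real.exp (-c) * Real.exp (∑ i, s i * (lam * a k i)) ≤
      ∑ k ∈ t, Real.exp (-c) * Real.exp (∑ i, s i * (lam * a k i)) :=
      Finset.single_le_sum (f := fun k => Real.exp (-c) * Real.exp (∑ i, s i * (lam * a k i)))
        (fun _ _ => by positivity) hk
    rw [← Real.exp_add] at h1
    have h2 := Real.add_one_le_exp (-c + ∑ i, s i * (lam * a k i))
    have h3 : ∑ i, s i * (lam * a k i) = lam * ∑ i, s i * a k i := by
      rw [Finset.mul_sum]; exact Finset.sum_congr rfl fun _ _ => by ring
    have h4 := mul_le_mul_of_nonneg_left hk2 hlam.le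
    linarith
  rw [rE_mul, rE_add, rE_const, rE_sum] at key
  have h5 : ∑ k ∈ t, rE n (fun s => Real.exp (-c) * Real.exp (∑ i, s i * (lam * a k i))) ≤ 1 := by
    have : ∀ k ∈ t, rE n (fun s => Real.exp (-c) * Real.exp (∑ i, s i * (lam * a k i))) ≤
        Real.exp (-c) * Real.exp (lam ^ 2 * q / 2) := by
      intro k hk
      rw [rE_mul]
      refine mul_le_mul_of_nonneg_left ((rE_exp_lin _).trans (Real.exp_le_exp.2 ?_))
        (Real.exp_pos _).le
      have := mul_le_mul_of_nonneg_left (hq k hk) (sq_nonneg lam)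
      rw [Finset.mul_sum] at this
      simp only [mul_pow]
      linarith
    refine (Finset.sum_le_sum this).trans ?_
    rw [Finset.sum_const, nsmul_eq_mul, ← Real.exp_add, hc]
    have : -(Real.log t.card + lam ^ 2 * q / 2) + lam ^ 2 * q / 2 = - Real.log t.card := by ring
    have hp : (0:ℝ) < t.card := by exact_mod_cast ht.card_pos
    rw [this, Real.exp_neg, Real.exp_log hp]
    exact (mul_inv_cancel₀ hp.ne').le
  have h6 : lam * rE n M ≤ c := by linarith
  have : Real.log t.card / lam + lam * q / 2 = c / lam := by rw [hc]; field_simp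
  rw [this, le_div_iff₀ hlam]; linarith

/-- two point contraction -/
lemma two_pt {ι : Type*} [Nonempty ι] (a p q : ι → ℝ)
    (hpq : ∀ i j, |p i - p j| ≤ |q i - q j|)
    (h1 : BddAbove (Set.range fun i => a i + q i)) (h2 : BddAbove (Set.range fun i => a i - q i)) :
    (⨆ i, (a i + p i)) + (⨆ i, (a i - p i)) ≤ (⨆ i, (a i + q i)) + (⨆ i, (a i - q i)) := by
  rw [← le_sub_iff_add_le]
  refine ciSup_le fun i => ?_
  rw [le_sub_comm]
  refine ciSup_le fun j => ?_
  have b1 := fun k => le_ciSup h1 k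
  have b2 := fun k => le_ciSup h2 k
  have := hpq i j
  have h3 := le_abs_self (p i - p j)
  have := b1 i; have := b1 j; have := b2 i; have := b2 j
  rcases abs_cases (q i - q j) with ⟨e, _⟩ | ⟨e, _⟩ <;> linarith

lemma bdd_lin {ι : Type*} {n : ℕ} (a : ι → ℝ) (K : ℝ) (ha : ∀ i, a i ≤ K)
    (v : ι → Fin n → ℝ) (B : ℝ) (hv : ∀ i j, |v i j| ≤ B) (s : Fin n → ℝ) :
    BddAbove (Set.range fun i => a i + ∑ j, s j * v i j) := by
  refine ⟨K + ∑ j, |s j| * B, ?_⟩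
  rintro _ ⟨i, rfl⟩
  refine add_le_add (ha i) (Finset.sum_le_sum fun j _ => ?_)
  refine (le_abs_self _).trans ?_
  rw [abs_mul]
  exact mul_le_mul_of_nonneg_left (hv i j) (abs_nonneg _)

lemma contraction {ι : Type*} [Nonempty ι] (B : ℝ) : ∀ {n : ℕ} (p q : ι → Fin n → ℝ)
    (a : ι → ℝ) (K : ℝ) (_ : ∀ i, a i ≤ K) (_ : ∀ i j, |p i j| ≤ B) (_ : ∀ i j, |q i j| ≤ B)
    (_ : ∀ i i' j, |p i j - p i' j| ≤ |q i j - q i' j|),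
    rE n (fun s => ⨆ i, (a i + ∑ j, s j * p i j)) ≤ rE n (fun s => ⨆ i, (a i + ∑ j, s j * q i j))
  | 0, p, q, a, K, _, _, _, _ => by simp [rE]
  | n + 1, p, q, a, K, ha, hp, hq, hpq => by
    simp only [rE, Fin.sum_univ_succ, Fin.cons_zero, Fin.cons_succ, ← add_assoc]
    have h1 := contraction B (fun i (j : Fin n) => p i j.succ) (fun i j => q i j.succ)
      (fun i => a i + 1 * p i 0) (K + B)
      (fun i => by have := abs_le.1 (hp i 0); have := ha i; linarith)
      (fun i j => hp i _) (fun i j => hq i _) (fun i i' j => hpq i i' _)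
    have h2 := contraction B (fun i (j : Fin n) => p i j.succ) (fun i j => q i j.succ)
      (fun i => a i + -1 * p i 0) (K + B)
      (fun i => by have := abs_le.1 (hp i 0); have := ha i; linarith)
      (fun i j => hp i _) (fun i j => hq i _) (fun i i' j => hpq i i' _)
    refine div_le_div_of_nonneg_right ((add_le_add h1 h2).trans ?_) (by norm_num)
    rw [← rE_add, ← rE_add]
    refine rE_mono fun s _ => ?_
    have := two_pt (fun i => a i + ∑ j : Fin n, s j * q i j.succ) (fun i => p i 0)
      (fun i => q i 0) (fun i i' => hpq i i' 0)
      (by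
        have := bdd_lin (fun i => a i + q i 0) (K + B)
          (fun i => by have := abs_le.1 (hq i 0); have := ha i; linarith)
          (fun i (j : Fin n) => q i j.succ) B (fun i j => hq i _) s
        convert this using 3; ring)
      (by
        have := bdd_lin (fun i => a i - q i 0) (K + B)
          (fun i => by have := abs_le.1 (hq i 0); have := ha i; linarith)
          (fun i (j : Fin n) => q i j.succ) B (fun i j => hq i _) s
        convert this using 3; ring)
    convert this using 4 <;> ring

lemma sauer_weight {m : ℕ} (𝒲 : Finset (Finset (Fin m))) (T : Finset (Fin m)) (d l : ℕ)
    (hT : T.card ≤ l) (hd : ∀ s, Finset.Shatters 𝒲 s → s.card ≤ d)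
    (hinj : ∀ A ∈ 𝒲, ∀ B ∈ 𝒲, A ∩ T = B ∩ T → A = B) (x : ℝ) (hx : 0 < x) (hx1 : x ≤ 1) :
    (𝒲.card : ℝ) * x ^ d ≤ Real.exp (x * l) := by
  set 𝒱 := 𝒲.image (· ∩ T) with h𝒱
  have hc : 𝒱.card = 𝒲.card := Finset.card_image_of_injOn (fun A hA B hB h => hinj A hA B hB h)
  have hs : ∀ s ∈ 𝒱.shatterer, s ⊆ T ∧ s.card ≤ d := by
    intro s hs
    rw [Finset.mem_shatterer] at hs
    have hsT : s ⊆ T := by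
      obtain ⟨u, hu, h⟩ := hs.exists_superset
      obtain ⟨A, hA, rfl⟩ := Finset.mem_image.1 hu
      exact h.trans Finset.inter_subset_right
    refine ⟨hsT, hd s ?_⟩
    intro t ht
    obtain ⟨u, hu, h⟩ := hs ht
    obtain ⟨A, hA, rfl⟩ := Finset.mem_image.1 hu
    refine ⟨A, hA, ?_⟩
    rw [← h]; ext i; simp only [Finset.mem_inter]
    exact ⟨fun h => ⟨h.1, h.2, hsT h.1⟩, fun h => ⟨h.1, h.2.1⟩⟩
  have h1 : (𝒲.card : ℝ) ≤ 𝒱.shatterer.card := by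
    rw [← hc]; exact_mod_cast Finset.card_le_card_shatterer 𝒱
  calc (𝒲.card : ℝ) * x ^ d ≤ 𝒱.shatterer.card * x ^ d := by gcongr
    _ = ∑ s ∈ 𝒱.shatterer, x ^ d := by simp
    _ ≤ ∑ s ∈ 𝒱.shatterer, x ^ s.card := Finset.sum_le_sum fun s h =>
        pow_le_pow_of_le_one hx.le hx1 (hs s h).2
    _ ≤ ∑ s ∈ T.powerset, x ^ s.card := Finset.sum_le_sum_of_subset_of_nonneg
        (fun s h => Finset.mem_powerset.2 (hs s h).1) (fun _ _ _ => by positivity)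
    _ = (1 + x) ^ T.card := by
        have := Finset.prod_one_add (f := fun _ : Fin m => x) T
        simp only [Finset.prod_const] at this
        exact this.symm
    _ ≤ (1 + x) ^ l := pow_le_pow_right₀ (by linarith) hT
    _ ≤ (Real.exp x) ^ l := by
        gcongr; have := Real.add_one_le_exp x; linarith
    _ = Real.exp (x * l) := by rw [← Real.exp_nat_mul]; ring_nf

lemma exists_tau {m : ℕ} (hm : 0 < m) (𝒲 : Finset (Finset (Fin m))) (h2 : 0 < 𝒲.card) (e : ℝ) (he : e ≤ 1)
    (hsep : ∀ A ∈ 𝒲, ∀ B ∈ 𝒲, A ≠ B → e * m ≤ (symmDiff A B).card) (l : ℕ)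
    (hl : 2 * Real.log 𝒲.card ≤ e * l) :
    ∃ T : Finset (Fin m), T.card ≤ l ∧ ∀ A ∈ 𝒲, ∀ B ∈ 𝒲, A ∩ T = B ∩ T → A = B := by
  by_contra hcon
  push Not at hcon
  have hN : (0:ℝ) < 𝒲.card := by exact_mod_cast h2
  have cov : (Finset.univ : Finset (Fin l → Fin m)) ⊆ 𝒲.offDiag.biUnion
      (fun P => Fintype.piFinset fun _ => (symmDiff P.1 P.2)ᶜ) := by
    intro τ _
    obtain ⟨A, hA, B, hB, h, hne⟩ := hcon (Finset.univ.image τ)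
      (Finset.card_image_le.trans (by simp))
    refine Finset.mem_biUnion.2 ⟨(A, B), Finset.mem_offDiag.2 ⟨hA, hB, hne⟩, ?_⟩
    refine Fintype.mem_piFinset.2 fun j => ?_
    have := congrArg (fun Q => τ j ∈ Q) h
    simp at this
    simp [this]
  have h3 := (Finset.card_le_card cov).trans Finset.card_biUnion_le
  have h4 : ((m:ℝ) ^ l) ≤ ∑ P ∈ 𝒲.offDiag, (m * (1 - e)) ^ l := by
    have : ((Finset.univ : Finset (Fin l → Fin m)).card : ℝ) = (m:ℝ)^l := by simp
    rw [← this]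
    refine le_trans (Nat.cast_le.2 h3) ?_
    push_cast
    refine Finset.sum_le_sum fun P hP => ?_
    obtain ⟨hA, hB, hne⟩ := Finset.mem_offDiag.1 hP
    have h5 := hsep _ hA _ hB hne
    rw [Fintype.card_piFinset]
    simp only [Finset.prod_const, Finset.card_univ, Fintype.card_fin]
    push_cast
    gcongr
    have h6 := Finset.card_add_card_compl (symmDiff P.1 P.2)
    have h7 : ((symmDiff P.1 P.2).card : ℝ) + ((symmDiff P.1 P.2)ᶜ.card : ℝ) = m := by
      have := congrArg (fun k : ℕ => (k:ℝ)) h6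
      simpa using this
    nlinarith
  rw [Finset.sum_const, nsmul_eq_mul, mul_pow] at h4
  have hmp : (0:ℝ) < (m:ℝ)^l := by positivity
  have h8 : (1 - e) ^ l ≤ Real.exp (-(2 * Real.log 𝒲.card)) := by
    calc (1 - e) ^ l ≤ (Real.exp (-e)) ^ l := by
          refine pow_le_pow_left₀ (by linarith) ?_ l
          · have := Real.add_one_le_exp (-e); linarith
      _ = Real.exp (-(e * l)) := by rw [← Real.exp_nat_mul]; ring_nf
      _ ≤ _ := Real.exp_le_exp.2 (by linarith)
  have h9 : Real.exp (-(2 * Real.log 𝒲.card)) = ((𝒲.card : ℝ) ^ 2)⁻¹ := by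
    rw [Real.exp_neg, two_mul, Real.exp_add, Real.exp_log hN, sq]
  rw [h9] at h8
  have h10 : (𝒲.offDiag.card : ℝ) < (𝒲.card : ℝ) ^ 2 := by
    rw [Finset.offDiag_card, sq]
    have : 𝒲.card * 𝒲.card - 𝒲.card < 𝒲.card * 𝒲.card := Nat.sub_lt (by positivity) h2
    exact_mod_cast this
  have h11 : (𝒲.offDiag.card : ℝ) * ((𝒲.card : ℝ) ^ 2)⁻¹ < 1 := by
    rw [← div_eq_mul_inv, div_lt_one (by positivity)]; exact h10
  have h12 : (𝒲.offDiag.card : ℝ) * (1 - e) ^ l < 1 :=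
    lt_of_le_of_lt (mul_le_mul_of_nonneg_left h8 (by positivity)) h11
  nlinarith

/-- packing bound -/
lemma packing {m : ℕ} (hm : 0 < m) (𝒲 : Finset (Finset (Fin m))) (h2 : 0 < 𝒲.card) (k d : ℕ) (hd1 : 1 ≤ d)
    (hd : ∀ s, Finset.Shatters 𝒲 s → s.card ≤ d)
    (hsep : ∀ A ∈ 𝒲, ∀ B ∈ 𝒲, A ≠ B → (1/4 : ℝ)^k * m ≤ (symmDiff A B).card) :
    Real.log 𝒲.card ≤ 4 * (k + 1) * d := by
  set e : ℝ := (1/4 : ℝ)^k with he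
  have he0 : 0 < e := by positivity
  have he1 : e ≤ 1 := pow_le_one₀ (by norm_num) (by norm_num)
  set L := Real.log 𝒲.card with hL
  have hN : (0:ℝ) < 𝒲.card := by exact_mod_cast h2
  have hL0 : 0 ≤ L := Real.log_nonneg (by exact_mod_cast h2)
  set l := ⌈2 * L / e⌉₊ with hl
  have hl1 : 2 * L / e ≤ l := Nat.le_ceil _
  have hl2 : (l:ℝ) < 2 * L / e + 1 := Nat.ceil_lt_add_one (by positivity)
  obtain ⟨T, hT, hinj⟩ := exists_tau hm 𝒲 h2 e he1 hsep l (by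
    rw [div_le_iff₀ he0] at hl1; linarith)
  have key := sauer_weight 𝒲 T d l hT hd hinj (e/4) (by positivity) (by linarith)
  have h3 := Real.log_le_log (by positivity) key
  rw [Real.log_exp, Real.log_mul hN.ne' (by positivity), Real.log_pow] at h3
  have h4 : Real.log (e / 4) = - ((k + 1) * Real.log 4) := by
    have : e / 4 = ((4:ℝ)^(k+1))⁻¹ := by
      rw [he, one_div, inv_pow, pow_succ]; field_simp
    rw [this, Real.log_inv, Real.log_pow]; push_cast; ring
  rw [h4] at h3
  have h5 : e / 4 * l ≤ L / 2 + 1/4 := by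
    have : e / 4 * l ≤ e / 4 * (2 * L / e + 1) := by gcongr
    have h6 : e / 4 * (2 * L / e + 1) = L / 2 + e / 4 := by field_simp; ring
    linarith
  have h6 : Real.log 4 ≤ 1.4 := by
    have : (4:ℝ) = 2 ^ 2 := by norm_num
    rw [this, Real.log_pow]
    have := Real.log_two_lt_d9
    push_cast; linarith
  have h7 : (1:ℝ) ≤ d := by exact_mod_cast hd1
  have h8 : (0:ℝ) ≤ k := by positivity
  have h9 : (d:ℝ) * ((k+1) * Real.log 4) ≤ d * ((k+1) * 1.4) := by gcongr
  nlinarith [mul_nonneg (by linarith : (0:ℝ) ≤ d) h8]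


def sg {m : ℕ} (A : Finset (Fin m)) (i : Fin m) : ℝ := if i ∈ A then 1 else -1

def MW {m : ℕ} (𝒲 : Finset (Finset (Fin m))) (s : Fin m → ℝ) : ℝ :=
  ⨆ A : 𝒲, ∑ i, s i * sg A.1 i

lemma le_MW {m : ℕ} {𝒲 : Finset (Finset (Fin m))} {A : Finset (Fin m)} (hA : A ∈ 𝒲)
    (s : Fin m → ℝ) : ∑ i, s i * sg A i ≤ MW 𝒲 s :=
  le_ciSup (f := fun A : 𝒲 => ∑ i, s i * sg A.1 i) (Set.finite_range _).bddAbove ⟨A, hA⟩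

lemma MW_eq {m : ℕ} {𝒲 : Finset (Finset (Fin m))} (h : 𝒲.Nonempty) (s : Fin m → ℝ) :
    ∃ A ∈ 𝒲, MW 𝒲 s = ∑ i, s i * sg A i := by
  have : Nonempty 𝒲 := h.to_subtype
  obtain ⟨A, hA⟩ := exists_eq_ciSup_of_finite (f := fun A : 𝒲 => ∑ i, s i * sg A.1 i)
  exact ⟨A.1, A.2, hA.symm⟩

lemma exists_net {m : ℕ} (𝒲 : Finset (Finset (Fin m))) (r : ℝ) (hr : 0 ≤ r) :
    ∃ 𝒱 ⊆ 𝒲, (∀ A ∈ 𝒱, ∀ B ∈ 𝒱, A ≠ B → r < (symmDiff A B).card) ∧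
      ∀ A ∈ 𝒲, ∃ B ∈ 𝒱, ((symmDiff A B).card : ℝ) ≤ r := by
  obtain ⟨𝒱, h𝒱, hmax⟩ := Finset.exists_max_image (𝒲.powerset.filter
    (fun 𝒱 => ∀ A ∈ 𝒱, ∀ B ∈ 𝒱, A ≠ B → r < (symmDiff A B).card)) Finset.card
    ⟨∅, by simp⟩
  rw [Finset.mem_filter, Finset.mem_powerset] at h𝒱
  refine ⟨𝒱, h𝒱.1, h𝒱.2, fun A hA => ?_⟩
  by_contra hcon
  push Not at hcon
  have hA𝒱 : A ∉ 𝒱 := fun h => by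
    have := hcon A h; simp at this; linarith
  have := hmax (insert A 𝒱) (by
    rw [Finset.mem_filter, Finset.mem_powerset]
    refine ⟨Finset.insert_subset hA h𝒱.1, ?_⟩
    intro B hB C hC hne
    rcases Finset.mem_insert.1 hB with rfl | hBV
    · rcases Finset.mem_insert.1 hC with rfl | hC
      · exact absurd rfl hne
      · exact hcon C hC
    · rcases Finset.mem_insert.1 hC with rfl | hC
      · rw [symmDiff_comm]; exact hcon B hBV
      · exact h𝒱.2 B hBV C hC hne)
  rw [Finset.card_insert_of_notMem hA𝒱] at this
  omega

lemma sg_diff {m : ℕ} (A B : Finset (Fin m)) :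
    ∑ i, (sg A i - sg B i) ^ 2 = 4 * (symmDiff A B).card := by
  have : ∀ i, (sg A i - sg B i) ^ 2 = if i ∈ symmDiff A B then 4 else 0 := by
    intro i
    simp only [sg, Finset.mem_symmDiff]
    by_cases h1 : i ∈ A <;> by_cases h2 : i ∈ B <;> simp [h1, h2] <;> norm_num
  simp only [this]
  rw [Finset.sum_ite_mem, Finset.univ_inter, Finset.sum_const, nsmul_eq_mul]; ring

lemma chain {m : ℕ} (hm : 0 < m) (d : ℕ) (hd1 : 1 ≤ d) : ∀ (k : ℕ) (𝒲 : Finset (Finset (Fin m))),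
    𝒲.Nonempty → (∀ s, Finset.Shatters 𝒲 s → s.card ≤ d) →
    (∀ A ∈ 𝒲, ∀ B ∈ 𝒲, A ≠ B → (1/4 : ℝ)^k * m < (symmDiff A B).card) →
    rE m (MW 𝒲) ≤ (20 - (4 * k + 20) * (1/2)^k) * Real.sqrt (d * m)
  | 0, 𝒲, hne, hd, hsep => by
    obtain ⟨A, hA⟩ := hne
    have h1 : rE m (MW 𝒲) = rE m (fun s => ∑ i, s i * sg A i) := by
      refine rE_congr fun s _ => ?_
      obtain ⟨B, hB, h⟩ := MW_eq ⟨A, hA⟩ s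
      rw [h]
      by_cases hAB : A = B
      · rw [hAB]
      · have h2 := hsep A hA B hB hAB
        have h3 := Finset.card_le_univ (symmDiff A B)
        simp at h2 h3
        omega
    rw [h1, rE_lin]; simp
  | k + 1, 𝒲, hne, hd, hsep => by
    obtain ⟨𝒱, hsub, hsep', hnet⟩ := exists_net 𝒲 ((1/4 : ℝ)^k * m) (by positivity)
    have hne' : 𝒱.Nonempty := by
      obtain ⟨A, hA⟩ := hne
      obtain ⟨B, hB, _⟩ := hnet A hA
      exact ⟨B, hB⟩
    have ih := chain hm d hd1 k 𝒱 hne' (fun s hs => hd s (hs.mono_left hsub)) hsep'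
    have pack := packing hm 𝒲 hne.card_pos (k+1) d hd1 hd (fun A hA B hB h => (hsep A hA B hB h).le)
    choose! π hπ1 hπ2 using hnet
    have hdp : (0:ℝ) < d := by exact_mod_cast hd1
    have hmp : (0:ℝ) < m := by exact_mod_cast hm
    set q := Real.sqrt (d * m) with hq
    have hqp : 0 < q := Real.sqrt_pos.2 (by positivity)
    have hqq : q * q = d * m := Real.mul_self_sqrt (by positivity)
    have ms := massart 𝒲 hne (fun A i => sg A i - sg (π A) i) (4 * ((1/4 : ℝ)^k * m))
      (2^(k+1) * (d / q)) (by positivity)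
      (fun A hA => by rw [sg_diff]; have := hπ2 A hA; linarith)
      (fun s => MW 𝒲 s - MW 𝒱 s) (fun s => by
        obtain ⟨A, hA, h⟩ := MW_eq hne s
        refine ⟨A, hA, ?_⟩
        have := le_MW (hπ1 A hA) s
        simp only [mul_sub, Finset.sum_sub_distrib]
        linarith)
    have h1 : rE m (MW 𝒲) = rE m (fun s => MW 𝒲 s - MW 𝒱 s) + rE m (MW 𝒱) := by
      rw [← rE_add]; simp
    have h2 : Real.log 𝒲.card / (2^(k+1) * (d / q)) ≤ 4 * (k + 2) * (1/2)^(k+1) * q := by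
      rw [div_le_iff₀ (by positivity)]
      refine pack.trans (le_of_eq ?_)
      push_cast
      rw [one_div, inv_pow]
      field_simp
      ring
    have h3 : 2^(k+1) * (d / q) * (4 * ((1/4 : ℝ)^k * m)) / 2 = 8 * (1/2)^(k+1) * q := by
      have : (1/4:ℝ)^k = (1/2)^k * (1/2)^k := by rw [← mul_pow]; norm_num
      have h4 : (2:ℝ)^k * (1/2)^k = 1 := by rw [← mul_pow]; norm_num
      have h5 : (d / q) * m = q := by field_simp; nlinarith
      rw [this]
      calc 2^(k+1) * (d / q) * (4 * ((1/2 : ℝ)^k * (1/2)^k * m)) / 2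
          = 4 * (2^k * (1/2)^k) * (1/2)^k * (d / q * m) := by ring
        _ = _ := by rw [h4, h5]; ring
    rw [h3] at ms
    rw [h1]
    have h6 : (20 - (4 * ((k + 1 : ℕ):ℝ) + 20) * (1/2)^(k+1)) * q =
      4 * (k + 2) * (1/2)^(k+1) * q + 8 * (1/2)^(k+1) * q +
        (20 - (4 * (k:ℝ) + 20) * (1/2)^k) * q := by
      push_cast; ring
    rw [h6]
    linarith

lemma rad_vc {m : ℕ} (hm : 0 < m) (d : ℕ) (hd1 : 1 ≤ d) (𝒲 : Finset (Finset (Fin m)))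
    (hne : 𝒲.Nonempty) (hd : ∀ s, Finset.Shatters 𝒲 s → s.card ≤ d) :
    rE m (MW 𝒲) ≤ 20 * Real.sqrt (d * m) := by
  have hmp : (0:ℝ) < m := by exact_mod_cast hm
  obtain ⟨k, hk⟩ := exists_pow_lt_of_lt_one (show (0:ℝ) < 1 / m by positivity)
    (show (1/4:ℝ) < 1 by norm_num)
  refine (chain hm d hd1 k 𝒲 hne hd ?_).trans ?_
  · intro A _ B _ hAB
    rw [lt_div_iff₀ hmp] at hk
    refine hk.trans_le ?_
    have : 0 < (symmDiff A B).card := by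
      rw [Finset.card_pos, Finset.nonempty_iff_ne_empty]
      intro h; exact hAB (symmDiff_eq_bot.1 h)
    exact_mod_cast this
  · have : 0 ≤ (4 * (k:ℝ) + 20) * (1/2)^k := by positivity
    gcongr; linarith

lemma rE_integral {Ω : Type*} [MeasurableSpace Ω] (Q : Measure Ω) : ∀ {n : ℕ}
    (F : (Fin n → ℝ) → Ω → ℝ), (∀ s, IsSgn s → Integrable (F s) Q) →
    Integrable (fun p => rE n (fun s => F s p)) Q ∧
      ∫ p, rE n (fun s => F s p) ∂Q = rE n (fun s => ∫ p, F s p ∂Q)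
  | 0, F, h => ⟨h _ (fun i => i.elim0), rfl⟩
  | n + 1, F, h => by
    obtain ⟨a1, a2⟩ := rE_integral Q (fun s => F (Fin.cons 1 s)) (fun s hs => h _ hs.cons1)
    obtain ⟨b1, b2⟩ := rE_integral Q (fun s => F (Fin.cons (-1) s)) (fun s hs => h _ hs.consm1)
    simp only [rE]
    refine ⟨(a1.add b1).div_const 2, ?_⟩
    rw [integral_div, integral_add a1 b1, a2, b2]

lemma integrable_bdd {Ω : Type*} [MeasurableSpace Ω] [Countable Ω] [MeasurableSingletonClass Ω]
    (Q : Measure Ω) [IsFiniteMeasure Q] (F : Ω → ℝ) (C : ℝ) (h : ∀ p, |F p| ≤ C) :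
    Integrable F Q :=
  Integrable.of_bound (Measurable.of_discrete).aestronglyMeasurable C
    (Filter.Eventually.of_forall h)

section core
set_option linter.unusedSectionVars false
variable {Z : Type*} [MeasurableSpace Z] [Countable Z] [MeasurableSingletonClass Z]
  {ι : Type*} [Nonempty ι] {m : ℕ}

def GG (g : ι → Z → ℝ) (s : Fin m → ℝ) (P : Fin m → Z × Z) : ℝ :=
  ⨆ j, ∑ i, s i * (g j (P i).2 - g j (P i).1)

lemma GG_bdd (g : ι → Z → ℝ) (hg : ∀ j z, 0 ≤ g j z ∧ g j z ≤ 1) (s : Fin m → ℝ)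
    (P : Fin m → Z × Z) :
    BddAbove (Set.range fun j => ∑ i, s i * (g j (P i).2 - g j (P i).1)) := by
  have := bdd_lin (fun _ : ι => (0:ℝ)) 0 (fun _ => le_rfl)
    (fun j i => g j (P i).2 - g j (P i).1) 1 (fun j i => by
      have := hg j (P i).2; have := hg j (P i).1; rw [abs_le]; constructor <;> linarith) s
  simpa using this

lemma GG_lip (g : ι → Z → ℝ) (hg : ∀ j z, 0 ≤ g j z ∧ g j z ≤ 1) (P : Fin m → Z × Z)
    (s s' : Fin m → ℝ) : GG g s P - GG g s' P ≤ ∑ i, |s i - s' i| := by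
  rw [sub_le_iff_le_add]
  refine ciSup_le fun j => ?_
  have h1 := le_ciSup (GG_bdd g hg s' P) j
  have h2 : ∑ i, s i * (g j (P i).2 - g j (P i).1) ≤ ∑ i, |s i - s' i| +
      ∑ i, s' i * (g j (P i).2 - g j (P i).1) := by
    rw [← Finset.sum_add_distrib]
    refine Finset.sum_le_sum fun i _ => ?_
    have h3 : (s i - s' i) * (g j (P i).2 - g j (P i).1) ≤ |s i - s' i| := by
      refine (le_abs_self _).trans ?_
      rw [abs_mul]
      refine mul_le_of_le_one_right (abs_nonneg _) ?_
      have := hg j (P i).2; have := hg j (P i).1; rw [abs_le]; constructor <;> linarith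
    linarith
  exact h2.trans (by unfold GG; linarith)

lemma GG_abs (g : ι → Z → ℝ) (hg : ∀ j z, 0 ≤ g j z ∧ g j z ≤ 1) (P : Fin m → Z × Z)
    (s : Fin m → ℝ) : |GG g s P| ≤ ∑ i, |s i| := by
  have h0 : GG g 0 P = 0 := by simp [GG]
  have h1 := GG_lip g hg P s 0
  have h2 := GG_lip g hg P 0 s
  simp only [h0, Pi.zero_apply, sub_zero, zero_sub, abs_neg] at h1 h2
  rw [abs_le]; constructor <;> linarith

lemma GG_rad (g : ι → Z → ℝ) (hg : ∀ j z, 0 ≤ g j z ∧ g j z ≤ 1) (R : ℝ)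
    (hR : ∀ z : Fin m → Z, rE m (fun s => ⨆ j, ∑ i, s i * g j (z i)) ≤ R) (P : Fin m → Z × Z) :
    rE m (fun s => GG g s P) ≤ 2 * R := by
  have hb : ∀ (s : Fin m → ℝ) (z : Fin m → Z), BddAbove (Set.range fun j => ∑ i, s i * g j (z i)) := by
    intro s z
    have := bdd_lin (fun _ : ι => (0:ℝ)) 0 (fun _ => le_rfl)
      (fun j i => g j (z i)) 1 (fun j i => by
        have := hg j (z i); rw [abs_le]; constructor <;> linarith) s
    simpa using this
  have h1 := hR (fun i => (P i).2)
  have h2 := hR (fun i => (P i).1)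
  rw [← rE_neg] at h2
  have h3 : rE m (fun s => GG g s P) ≤ rE m (fun s => (⨆ j, ∑ i, s i * g j (P i).2) +
      ⨆ j, ∑ i, (-s) i * g j (P i).1) := by
    refine rE_mono fun s _ => ciSup_le fun j => ?_
    have a1 := le_ciSup (hb s (fun i => (P i).2)) j
    have a2 := le_ciSup (hb (-s) (fun i => (P i).1)) j
    refine le_trans (le_of_eq ?_) (add_le_add a1 a2)
    rw [← Finset.sum_add_distrib]
    exact Finset.sum_congr rfl fun i _ => by simp; ring
  rw [rE_add] at h3
  linarith

lemma core (D : Measure Z) [IsProbabilityMeasure D] (g : ι → Z → ℝ)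
    (hg : ∀ j z, 0 ≤ g j z ∧ g j z ≤ 1) (R : ℝ)
    (hR : ∀ z : Fin m → Z, rE m (fun s => ⨆ j, ∑ i, s i * g j (z i)) ≤ R) (ε : ℝ) (hε : 0 < ε) :
    (Measure.pi fun _ : Fin m => D)
      {S | ∃ j, ∑ i, g j (S i) + 2 * R + m * ε < m * ∫ z, g j z ∂D} ≤
      ENNReal.ofReal (Real.exp (-(m * ε ^ 2 / 2))) := by
  set μ := Measure.pi fun _ : Fin m => D with hμ
  set Q := Measure.pi fun _ : Fin m => D.prod D with hQ
  have hexpb : ∀ s (P : Fin m → Z × Z), |Real.exp (ε * GG g s P)| ≤ Real.exp (ε * ∑ i, |s i|) := by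
    intro s P
    rw [abs_of_pos (Real.exp_pos _)]
    refine Real.exp_le_exp.2 (mul_le_mul_of_nonneg_left ?_ hε.le)
    exact (le_abs_self _).trans (GG_abs g hg P s)
  have hExpInt : ∀ s, Integrable (fun P => Real.exp (ε * GG g s P)) Q := fun s =>
    integrable_bdd Q _ _ (hexpb s)
  -- symmetrized bound
  have hsym : ∫ P, Real.exp (ε * GG g 1 P) ∂Q ≤ Real.exp (2 * ε * R + m * ε ^ 2 / 2) := by
    have hs : ∀ s, IsSgn s → ∫ P, Real.exp (ε * GG g s P) ∂Q = ∫ P, Real.exp (ε * GG g 1 P) ∂Q := by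
      intro s hs
      have mp : MeasurePreserving (fun (P : Fin m → Z × Z) i =>
          (if s i = 1 then id else Prod.swap : Z × Z → Z × Z) (P i)) Q Q := by
        refine measurePreserving_pi _ _ fun i => ?_
        split_ifs
        · exact MeasurePreserving.id _
        · exact Measure.measurePreserving_swap
      have := mp.integral_comp' (f := MeasurableEquiv.ofInvolutive _ (by
        intro P; funext i; by_cases h : s i = 1 <;> simp [h]) mp.measurable)
        (fun P => Real.exp (ε * GG g 1 P))
      rw [← this]
      congr 1; funext P
      congr 2
      unfold GG
      congr 1; funext j
      refine Finset.sum_congr rfl fun i _ => ?_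
      rcases hs i with h | h
      · simp [h, MeasurableEquiv.ofInvolutive, Function.Involutive.toPerm]
      · have : ¬ ((-1:ℝ) = 1) := by norm_num
        simp [h, this, MeasurableEquiv.ofInvolutive, Function.Involutive.toPerm]
    obtain ⟨i1, i2⟩ := rE_integral Q (fun s P => Real.exp (ε * GG g s P)) (fun s _ => hExpInt s)
    have h1 : ∫ P, Real.exp (ε * GG g 1 P) ∂Q = rE m (fun s => ∫ P, Real.exp (ε * GG g s P) ∂Q) := by
      rw [rE_congr hs, rE_const]
    rw [h1, ← i2]
    have h2 : ∀ P, rE m (fun s => Real.exp (ε * GG g s P)) ≤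
        Real.exp (2 * ε * R + m * ε ^ 2 / 2) := by
      intro P
      refine (rE_mcd ε (fun s => GG g s P) ?_).trans (Real.exp_le_exp.2 ?_)
      · intro s s'
        have a1 := GG_lip g hg P s s'
        have a2 := GG_lip g hg P s' s
        simp only [abs_sub_comm (s' _)] at a2
        rw [abs_le]; constructor <;> linarith
      · have := mul_le_mul_of_nonneg_left (GG_rad g hg R hR P) hε.le
        linarith
    calc _ ≤ ∫ P, Real.exp (2 * ε * R + m * ε ^ 2 / 2) ∂Q :=
          integral_mono i1 (integrable_const _) h2
      _ = _ := by simp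
  -- transfer to product
  let pr : (Fin m → Z) × (Fin m → Z) → (Fin m → Z × Z) := fun SS i => (SS.1 i, SS.2 i)
  have hprod : ∫ SS, Real.exp (ε * GG g 1 (pr SS)) ∂(μ.prod μ) =
      ∫ P, Real.exp (ε * GG g 1 P) ∂Q := by
    have := (measurePreserving_arrowProdEquivProdArrow Z Z (Fin m) (fun _ => D)
      (fun _ => D)).integral_comp' (fun SS => Real.exp (ε * GG g 1 (pr SS)))
    rw [← this]
    rfl
  have hint2 : Integrable (fun SS => Real.exp (ε * GG g 1 (pr SS))) (μ.prod μ) :=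
    integrable_bdd _ _ _ fun SS => hexpb 1 (pr SS)
  rw [integral_prod _ hint2] at hprod
  set Ψ : (Fin m → Z) → ℝ := fun S => ∫ S', Real.exp (ε * GG g 1 (pr (S, S'))) ∂μ with hΨ
  have hΨ0 : ∀ S, 0 ≤ Ψ S := fun S => integral_nonneg fun _ => (Real.exp_pos _).le
  have hΨint : Integrable Ψ μ := hint2.integral_prod_left
  -- the bad set
  set c := Real.exp (ε * (2 * R + m * ε)) with hc
  have hsub : {S | ∃ j, ∑ i, g j (S i) + 2 * R + m * ε < m * ∫ z, g j z ∂D} ⊆ {S | c ≤ Ψ S} := by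
    rintro S ⟨j, hj⟩
    have hgi : ∀ i : Fin m, Integrable (fun S' : Fin m → Z => g j (S' i)) μ := fun i =>
      integrable_bdd _ _ 1 fun S' => by
        have := hg j (S' i); rw [abs_le]; constructor <;> linarith
    have e1 : ∀ i : Fin m, ∫ S', g j (S' i) ∂μ = ∫ z, g j z ∂D := by
      intro i
      have mp := measurePreserving_eval (fun _ : Fin m => D) i
      have := integral_map (μ := Measure.pi fun _ : Fin m => D) mp.measurable.aemeasurable (f := g j)
        (Measurable.of_discrete).aestronglyMeasurable
      rw [mp.map_eq] at this
      exact this.symm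
    let L : (Fin m → Z) → ℝ := fun S' => ε * ∑ i, (g j (S' i) - g j (S i))
    have hLint : Integrable L μ := by
      refine Integrable.const_mul (integrable_finsetSum _ fun i _ => ?_) ε
      exact (hgi i).sub (integrable_const _)
    have e2 : ∫ S', L S' ∂μ = ε * (m * ∫ z, g j z ∂D - ∑ i, g j (S i)) := by
      have hfs := integral_finsetSum (μ := μ) (Finset.univ : Finset (Fin m))
        (f := fun i S' => g j (S' i) - g j (S i))
        (fun i _ => (hgi i).sub (integrable_const _))
      rw [integral_const_mul, hfs]
      congr 1
      have : ∀ i : Fin m, ∫ S', (g j (S' i) - g j (S i)) ∂μ = ∫ z, g j z ∂D - g j (S i) := by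
        intro i
        rw [integral_sub (hgi i) (integrable_const _), e1]; simp
      simp [this]
    have hle : ∀ S', L S' ≤ ε * GG g 1 (pr (S, S')) := by
      intro S'
      have := le_ciSup (GG_bdd g hg 1 (pr (S, S'))) j
      refine mul_le_mul_of_nonneg_left ?_ hε.le
      refine le_trans (le_of_eq ?_) this
      simp [pr]
    have hEi : Integrable (fun S' => Real.exp (ε * GG g 1 (pr (S, S')))) μ :=
      integrable_bdd _ _ _ fun SS => hexpb 1 (pr (S, SS))
    have hEL : Integrable (fun S' => Real.exp (L S')) μ := by
      refine hEi.mono' (Measurable.of_discrete).aestronglyMeasurable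
        (Filter.Eventually.of_forall fun S' => ?_)
      rw [Real.norm_eq_abs, abs_of_pos (Real.exp_pos _)]
      exact Real.exp_le_exp.2 (hle S')
    have jen : Real.exp (∫ S', L S' ∂μ) ≤ ∫ S', Real.exp (L S') ∂μ :=
      convexOn_exp.map_integral_le Real.continuous_exp.continuousOn isClosed_univ
        (by simp) hLint hEL
    calc c ≤ Real.exp (∫ S', L S' ∂μ) := by
          rw [e2]; exact Real.exp_le_exp.2 (mul_le_mul_of_nonneg_left (by linarith) hε.le)
      _ ≤ _ := jen
      _ ≤ Ψ S := integral_mono hEL hEi fun S' => Real.exp_le_exp.2 (hle S')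
  refine (measure_mono hsub).trans ?_
  have mk := mul_meas_ge_le_integral_of_nonneg (Filter.Eventually.of_forall hΨ0) hΨint c
  rw [hprod] at mk
  have hcp : 0 < c := Real.exp_pos _
  rw [← ENNReal.ofReal_toReal (measure_ne_top μ {S | c ≤ Ψ S})]
  refine ENNReal.ofReal_le_ofReal ?_
  have h9 : c * μ.real {S | c ≤ Ψ S} ≤ c * Real.exp (-(m * ε ^ 2 / 2)) := by
    refine (mk.trans hsym).trans (le_of_eq ?_)
    rw [hc, ← Real.exp_add]; congr 1; ring
  exact le_of_mul_le_mul_left h9 hcp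

end core

/-- label of a boolean -/
def yv (b : Bool) : ℝ := if b then 1 else -1

lemma yv_cases (b : Bool) : yv b = 1 ∨ yv b = -1 := by cases b <;> simp [yv]

lemma sgn_eq {a b c : ℝ} (ha : a = 1 ∨ a = -1) (hb : b = 1 ∨ b = -1) (hc : c = 1 ∨ c = -1)
    (h : a * b = 1 ↔ a * c = 1) : b = c := by
  rcases ha with rfl | rfl <;> rcases hb with rfl | rfl <;> rcases hc with rfl | rfl <;>
    first | rfl | (exfalso; norm_num at h)

def famW {X : Type*} (H : Set (X → ℝ)) {m : ℕ} (z : Fin m → X × Bool) : Finset (Finset (Fin m)) :=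
  Finset.univ.filter fun A => ∃ h ∈ H, ∀ i, i ∈ A ↔ yv (z i).2 * h (z i).1 = 1

lemma famW_vc {X : Type*} (H : Set (X → ℝ)) (hH : IsHypClass H) (d : ℕ) (hd : VCDim H d) {m : ℕ}
    (z : Fin m → X × Bool) (s : Finset (Fin m)) (hs : Finset.Shatters (famW H z) s) :
    s.card ≤ d := by
  by_contra hcon
  push Not at hcon
  obtain ⟨s', hs', hc⟩ := Finset.exists_subset_card_eq (show d + 1 ≤ s.card by omega)
  have hsh := hs.mono_right hs'
  refine hd.2 ⟨fun j => (z (s'.orderEmbOfFin hc j)).1, fun y hy => ?_⟩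
  set em := s'.orderEmbOfFin hc with hem
  obtain ⟨A, hA, hAs⟩ := hsh (t := (Finset.univ.filter
      (fun j => yv (z (em j)).2 * y j = 1)).map em.toEmbedding) (by
    intro i hi
    obtain ⟨j, _, rfl⟩ := Finset.mem_map.1 hi
    exact Finset.orderEmbOfFin_mem s' hc j)
  obtain ⟨h, hh, hA⟩ := (Finset.mem_filter.1 hA).2
  refine ⟨h, hh, fun j => sgn_eq (yv_cases (z (em j)).2) (hH h hh _) (hy j) ?_⟩
  rw [← hA]
  have h1 : em j ∈ A ↔ em j ∈ s' ∩ A := by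
    simp [hem, Finset.orderEmbOfFin_mem s' hc j]
  rw [h1, hAs]
  simp

lemma rad_H {X : Type*} (H : Set (X → ℝ)) (hH : IsHypClass H) (d : ℕ) (hd : VCDim H d)
    (hd1 : 1 ≤ d) (t : ℕ) {m : ℕ} (hm : 0 < m) (z : Fin m → X × Bool) (θ : ℝ) (hθ : 0 < θ)
    [Nonempty (DeltaT H t)] :
    rE m (fun s => ⨆ f : DeltaT H t, ∑ i, s i * (yv (z i).2 * f.1 (z i).1 / θ)) ≤
      20 * Real.sqrt (d * m) / θ := by
  have hmem : ∀ h ∈ H, ∃ A ∈ famW H z, ∀ i, sg A i = yv (z i).2 * h (z i).1 := by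
    intro h hh
    refine ⟨Finset.univ.filter fun i => yv (z i).2 * h (z i).1 = 1, ?_, ?_⟩
    · exact Finset.mem_filter.2 ⟨Finset.mem_univ _, h, hh, fun i => by simp⟩
    · intro i
      rcases yv_cases (z i).2 with e | e <;> rcases hH h hh (z i).1 with e' | e' <;>
        simp [sg, e, e'] <;> norm_num
  have hHne : ∃ h, h ∈ H := by
    obtain ⟨x, hx⟩ := hd.1
    obtain ⟨h, hh, _⟩ := hx (fun _ => 1) (fun _ => Or.inl rfl)
    exact ⟨h, hh⟩
  have hne : (famW H z).Nonempty := by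
    obtain ⟨h, hh⟩ := hHne
    obtain ⟨A, hA, _⟩ := hmem h hh
    exact ⟨A, hA⟩
  have hrad := rad_vc hm d hd1 (famW H z) hne (fun s hs => famW_vc H hH d hd z s hs)
  rcases Nat.eq_zero_or_pos t with rfl | ht
  · have : rE m (fun s => ⨆ f : DeltaT H 0, ∑ i, s i * (yv (z i).2 * f.1 (z i).1 / θ)) ≤
        rE m (fun _ => 0) := by
      refine rE_mono fun s _ => ciSup_le fun f => ?_
      obtain ⟨f, hs, _, rfl⟩ := f
      simp
    rw [rE_const] at this
    exact this.trans (by positivity)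
  · have htp : (0:ℝ) < t := by exact_mod_cast ht
    have : rE m (fun s => ⨆ f : DeltaT H t, ∑ i, s i * (yv (z i).2 * f.1 (z i).1 / θ)) ≤
        rE m (fun s => (1 / θ) * MW (famW H z) s) := by
      refine rE_mono fun s _ => ciSup_le fun f => ?_
      obtain ⟨f, hs, hsH, rfl⟩ := f
      have e1 : ∑ i, s i * (yv (z i).2 * ((∑ j, hs j (z i).1) / (t:ℝ)) / θ) =
          (1 / θ) * ((∑ j, ∑ i, s i * (yv (z i).2 * hs j (z i).1)) / t) := by
        rw [Finset.sum_comm, Finset.sum_div, Finset.mul_sum]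
        refine Finset.sum_congr rfl fun i _ => ?_
        simp only [← Finset.mul_sum]
        field_simp
      rw [e1]
      refine mul_le_mul_of_nonneg_left ?_ (by positivity)
      rw [div_le_iff₀ htp]
      have e2 : ∀ j ∈ (Finset.univ : Finset (Fin t)),
          ∑ i, s i * (yv (z i).2 * hs j (z i).1) ≤ MW (famW H z) s := by
        intro j _
        obtain ⟨A, hA, hA2⟩ := hmem (hs j) (hsH j)
        simp only [← hA2]
        exact le_MW hA s
      have := Finset.sum_le_card_nsmul _ _ _ e2
      simp only [Finset.card_univ, Fintype.card_fin, nsmul_eq_mul] at this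
      linarith
    rw [rE_mul] at this
    refine this.trans ?_
    rw [one_div, inv_mul_eq_div]
    gcongr

/-- the ramp -/
def ramp (γ' θ u : ℝ) : ℝ := max 0 (min 1 (γ' / θ - u / θ))

lemma ramp_lip (γ' θ u v : ℝ) : |ramp γ' θ u - ramp γ' θ v| ≤ |u / θ - v / θ| := by
  unfold ramp
  calc _ ≤ |min 1 (γ' / θ - u / θ) - min 1 (γ' / θ - v / θ)| := by
        have := abs_max_sub_max_le_abs (min 1 (γ' / θ - u / θ)) (min 1 (γ' / θ - v / θ)) 0
        simpa [max_comm] using this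
    _ ≤ |(γ' / θ - u / θ) - (γ' / θ - v / θ)| := by
        have := abs_min_sub_min_le_max 1 (γ' / θ - u / θ) 1 (γ' / θ - v / θ)
        simpa using this
    _ = _ := by rw [abs_sub_comm]; congr 1; ring

lemma main_Z {X : Type*} [MeasurableSpace X] [MeasurableSingletonClass X] [Countable X]
    (H : Set (X → ℝ)) (d t m : ℕ) (D : Measure (X × Bool)) [IsProbabilityMeasure D]
    (hH : IsHypClass H) (hd : VCDim H d) (hd1 : 1 ≤ d) (hdm : d ≤ m)
    (γ ξ δ : ℝ) (hγ : 0 < γ) (hξ : 1 < ξ) (hδ : 0 < δ) (hδ1 : δ < 1) :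
    (Measure.pi fun _ : Fin m => D)
      {S | ¬ ∀ f ∈ DeltaT H t,
        D {p | yv p.2 * f p.1 ≤ γ} ≤ ENNReal.ofReal ((1 / (m : ℝ)) *
          (∑ i : Fin m, if yv (S i).2 * f (S i).1 ≤ ξ * γ then (1 : ℝ) else 0) +
            40 * Real.sqrt (2 * d / (((ξ - 1) * γ) ^ 2 * m)) +
            Real.sqrt (2 * Real.log (2 / δ) / m))} ≤ ENNReal.ofReal δ := by
  have hm : 0 < m := by omega
  have hmp : (0:ℝ) < m := by exact_mod_cast hm
  have hdp : (0:ℝ) < d := by exact_mod_cast hd1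
  set θ := (ξ - 1) * γ with hθd
  have hθ : 0 < θ := mul_pos (by linarith) hγ
  set ε := Real.sqrt (2 * Real.log (2 / δ) / m) with hεd
  have hlog : 0 < Real.log (2 / δ) := Real.log_pos (by rw [lt_div_iff₀ hδ]; linarith)
  have hε : 0 < ε := Real.sqrt_pos.2 (by positivity)
  have hε2 : m * ε ^ 2 / 2 = Real.log (2 / δ) := by
    rw [hεd, Real.sq_sqrt (by positivity)]; field_simp
  have : Nonempty (DeltaT H t) := by
    obtain ⟨x, hx⟩ := hd.1
    obtain ⟨h, hh, _⟩ := hx (fun _ => 1) (fun _ => Or.inl rfl)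
    exact ⟨_, fun _ => h, fun _ => hh, rfl⟩
  have hfb : ∀ (f : DeltaT H t) x, |f.1 x| ≤ 1 := by
    rintro ⟨_, hs, hsH, rfl⟩ x
    simp only
    rw [abs_div, Nat.abs_cast]
    refine div_le_one_of_le₀ ?_ (by positivity)
    refine (Finset.abs_sum_le_sum_abs _ _).trans ?_
    have : ∀ i ∈ (Finset.univ : Finset (Fin t)), |hs i x| ≤ 1 := by
      intro i _
      rcases hH _ (hsH i) x with e | e <;> simp [e]
    have := Finset.sum_le_card_nsmul _ _ _ this
    simpa using this
  let g : DeltaT H t → X × Bool → ℝ := fun f z => ramp (ξ * γ) θ (yv z.2 * f.1 z.1)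
  have hg : ∀ f z, 0 ≤ g f z ∧ g f z ≤ 1 := fun f z =>
    ⟨le_max_left _ _, max_le (by norm_num) (min_le_left _ _)⟩
  have hR : ∀ z : Fin m → X × Bool, rE m (fun s => ⨆ f, ∑ i, s i * g f (z i)) ≤
      20 * Real.sqrt (d * m) / θ := by
    intro z
    have := contraction (ι := DeltaT H t) (1 + 1 / θ) (fun f i => g f (z i))
      (fun f i => yv (z i).2 * f.1 (z i).1 / θ) (fun _ => 0) 0 (fun _ => le_rfl)
      (fun f i => by
        have := hg f (z i)
        have h2 : 0 < 1 / θ := by positivity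
        rw [abs_le]; constructor <;> linarith)
      (fun f i => by
        rw [abs_div, abs_mul, abs_of_pos hθ]
        have h1 : |yv (z i).2| = 1 := by rcases yv_cases (z i).2 with e | e <;> simp [e]
        rw [h1, one_mul]
        have : |f.1 (z i).1| / θ ≤ 1 / θ := by gcongr; exact hfb f _
        linarith)
      (fun f f' i => ramp_lip _ _ _ _)
    simp only [zero_add] at this
    exact this.trans (rad_H H hH d hd hd1 t hm z θ hθ)
  refine le_trans (measure_mono ?_) ((core D g hg _ hR ε hε).trans ?_)
  · intro S hS
    simp only [Set.mem_ofPred_eq, not_forall, not_le] at hS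
    obtain ⟨f, hf, hS⟩ := hS
    refine ⟨⟨f, hf⟩, ?_⟩
    have gint : Integrable (g ⟨f, hf⟩) D := integrable_bdd D _ 1 fun z => by
      have := hg ⟨f, hf⟩ z; rw [abs_le]; constructor <;> linarith
    have h1 : D {p | yv p.2 * f p.1 ≤ γ} ≤ ENNReal.ofReal (∫ z, g ⟨f, hf⟩ z ∂D) := by
      have mk := mul_meas_ge_le_integral_of_nonneg
        (Filter.Eventually.of_forall fun z => (hg ⟨f, hf⟩ z).1) gint 1
      rw [one_mul] at mk
      refine le_trans (measure_mono ?_) (ENNReal.le_ofReal_iff_toReal_le (measure_ne_top D _)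
        (integral_nonneg fun z => (hg ⟨f, hf⟩ z).1) |>.2 mk)
      intro z hz
      simp only [Set.mem_ofPred_eq] at hz ⊢
      refine le_max_of_le_right (le_min le_rfl ?_)
      rw [← sub_div, le_div_iff₀ hθ, hθd]
      linarith
    have h2 := lt_of_lt_of_le hS h1
    have h3 := lt_of_not_ge fun h => absurd (ENNReal.ofReal_le_ofReal h) (not_le.2 h2)
    have h4 : ∑ i, g ⟨f, hf⟩ (S i) ≤
        ∑ i : Fin m, if yv (S i).2 * f (S i).1 ≤ ξ * γ then (1 : ℝ) else 0 := by
      refine Finset.sum_le_sum fun i _ => ?_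
      split_ifs with hi
      · exact (hg _ _).2
      · refine max_le le_rfl ((min_le_right _ _).trans ?_)
        rw [← sub_div]
        exact div_nonpos_of_nonpos_of_nonneg (by simp only; linarith) hθ.le
    have h5 : Real.sqrt (d * m) / (θ * m) ≤ Real.sqrt (2 * d / (θ ^ 2 * m)) := by
      refine Real.le_sqrt_of_sq_le ?_
      rw [div_pow, Real.sq_sqrt (by positivity), div_le_div_iff₀ (by positivity) (by positivity)]
      have : 0 ≤ d * m * (θ ^ 2 * (m:ℝ)) := by positivity
      nlinarith
    have h6 : 2 * (20 * Real.sqrt (d * m) / θ) ≤ m * (40 * Real.sqrt (2 * d / (θ ^ 2 * m))) := by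
      have := mul_le_mul_of_nonneg_left h5 (show (0:ℝ) ≤ m * 40 by positivity)
      refine le_trans (le_of_eq ?_) (this.trans (le_of_eq (by ring)))
      field_simp; ring
    have h7 := mul_lt_mul_of_pos_left h3 hmp
    rw [mul_add, mul_add, ← mul_assoc, mul_one_div_cancel hmp.ne', one_mul] at h7
    linarith
  · refine ENNReal.ofReal_le_ofReal ?_
    rw [hε2, Real.exp_neg, Real.exp_log (by positivity), inv_div]
    linarith

/-- uniform relative margin bound for voting classifiers: there is a
universal constant C > 1 such that with probability at least 1−δ over S ~ D^m, every
f ∈ Δ^t(H) satisfies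
P_{(x,y)~D}[y·f(x) ≤ γ] ≤ (1/m)·#{i : y_i·f(x_i) ≤ ξγ} + C·√(2d/(((ξ−1)γ)²m)) + √(2ln(2/δ)/m). -/
theorem statement5 :
    ∃ C : ℝ, 1 < C ∧
      ∀ (X : Type*) [MeasurableSpace X] [MeasurableSingletonClass X] [Countable X]
        [Nonempty X]
        (H : Set (X → ℝ)) (d t m : ℕ) (D : Measure (X × ℝ)),
        IsProbabilityMeasure D →
        IsHypClass H → VCDim H d → 1 ≤ d → d ≤ m →
        D {p : X × ℝ | p.2 = 1 ∨ p.2 = -1} = 1 →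
        ∀ γ ξ δ : ℝ, 0 < γ → γ < 1 → 1 < ξ → 0 < δ → δ < 1 →
          (Measure.pi fun _ : Fin m => D)
              {S | ¬ ∀ f ∈ DeltaT H t,
                D {p : X × ℝ | p.2 * f p.1 ≤ γ} ≤
                  ENNReal.ofReal
                    ((1 / (m : ℝ)) *
                        (∑ i : Fin m,
                          if (S i).2 * f (S i).1 ≤ ξ * γ then (1 : ℝ) else 0) +
                      C * Real.sqrt (2 * d / (((ξ - 1) * γ) ^ 2 * m)) +
                      Real.sqrt (2 * Real.log (2 / δ) / m))} ≤
            ENNReal.ofReal δ := by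
  refine ⟨40, by norm_num, ?_⟩
  intro X _ _ _ _ H d t m D hD hH hd hd1 hdm hlab γ ξ δ hγ _ hξ hδ hδ1
  let e : X × Bool → X × ℝ := fun z => (z.1, yv z.2)
  let r : X × ℝ → X × Bool := fun p => (p.1, decide (p.2 = 1))
  have hr : Measurable r := by
    refine measurable_fst.prodMk ?_
    exact Measurable.comp (g := fun y : ℝ => decide (y = 1)) (by
      refine measurable_to_bool ?_
      have : (fun y : ℝ => decide (y = 1)) ⁻¹' {true} = {1} := by ext; simp
      rw [this]; exact measurableSet_singleton _) measurable_snd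
  have he : Measurable e := Measurable.of_discrete
  have einj : Function.Injective e := by
    rintro ⟨x, b⟩ ⟨x', b'⟩ h
    simp only [e, Prod.mk.injEq] at h
    obtain ⟨rfl, h⟩ := h
    have : ¬ ((1:ℝ) = -1) := by norm_num
    have h' : ¬ ((-1:ℝ) = 1) := by norm_num
    cases b <;> cases b' <;> simp [yv, this, h'] at h ⊢
  have eemb : MeasurableEmbedding e :=
    ⟨einj, he, fun s _ => (Set.Countable.image (Set.to_countable s) e).measurableSet⟩
  set D0 := D.map r with hD0
  have : IsProbabilityMeasure D0 := Measure.isProbabilityMeasure_map hr.aemeasurable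
  have hDe : D0.map e = D := by
    rw [hD0, Measure.map_map he hr]
    have hae : (e ∘ r) =ᵐ[D] id := by
      have hms : MeasurableSet {p : X × ℝ | p.2 = 1 ∨ p.2 = -1} := by
        have : {p : X × ℝ | p.2 = 1 ∨ p.2 = -1} = Prod.snd ⁻¹' ({1, -1} : Set ℝ) := by
          ext; simp
        rw [this]; exact measurable_snd (Set.toFinite _).measurableSet
      have : ∀ᵐ p ∂D, p ∈ {p : X × ℝ | p.2 = 1 ∨ p.2 = -1} :=
        (prob_compl_eq_zero_iff hms).2 hlab
      filter_upwards [this] with p hp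
      have h' : ¬ ((-1:ℝ) = 1) := by norm_num
      obtain ⟨x, y⟩ := p
      rcases hp with h | h <;> simp only at h <;> subst h <;> simp [e, r, yv, h']
    rw [Measure.map_congr hae, Measure.map_id]
  let E : (Fin m → X × Bool) → (Fin m → X × ℝ) := fun S i => e (S i)
  have hE : Measurable E := Measurable.of_discrete
  have Einj : Function.Injective E := fun S S' h => funext fun i => einj (congrFun h i)
  have Eemb : MeasurableEmbedding E :=
    ⟨Einj, hE, fun s _ => (Set.Countable.image (Set.to_countable s) E).measurableSet⟩
  have hpi : (Measure.pi fun _ : Fin m => D) = (Measure.pi fun _ : Fin m => D0).map E := by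
    have : MeasurePreserving E (Measure.pi fun _ : Fin m => D0) (Measure.pi fun _ : Fin m => D) :=
      measurePreserving_pi _ _ fun i => ⟨he, hDe⟩
    exact this.map_eq.symm
  rw [hpi, Eemb.map_apply]
  have hset : ∀ f : X → ℝ, D {p : X × ℝ | p.2 * f p.1 ≤ γ} =
      D0 {p | yv p.2 * f p.1 ≤ γ} := by
    intro f
    rw [← hDe, eemb.map_apply]; rfl
  simp only [hset]
  exact main_Z H d t m D0 hH hd hd1 hdm γ ξ δ hγ hξ hδ hδ1

end
end

section
/- Let 0 < γ < 1/2 and 0 < θ < 2γ, and set α = (1/2)·ln((1+2γ)/(1−2γ)) − (1/2)·ln((1+θ)/(1−θ)), which is positive. Suppose α_j = α for all j = 1,…,t, and suppose that for each j the weighted error satisfies Σ_{i=1}^m D_j(i)·1{h_j(x_i) ≠ y_i} ≤ 1/2 − γ. Then the empirical θ-margin loss of f = (1/t)·Σ_{j=1}^t h_j satisfies (1/m)·#{ i ∈ {1,…,m} : y_i·f(x_i) ≤ θ } ≤ ( exp((θ−1)·α)·(1/2+γ) + exp((θ+1)·α)·(1/2−γ) )^t. -/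
open Classical

lemma ada_aux {X : Type*} (m : ℕ) (hm : 0 < m)
    (x : Fin m → X) (y : Fin m → ℝ) (hy : ∀ i, y i = 1 ∨ y i = -1)
    (γ a : ℝ) (ha : 0 < a) (t : ℕ) :
    ∀ (h : Fin t → X → ℝ) (_ : ∀ j z, h j z = 1 ∨ h j z = -1)
    (D : Fin (t + 1) → Fin m → ℝ) (Z : Fin t → ℝ)
    (_ : ∀ i, D 0 i = 1 / m)
    (_ : ∀ j : Fin t, Z j = ∑ i, D j.castSucc i * Real.exp (-a * y i * h j (x i)))
    (_ : ∀ (j : Fin t) (i),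
      D j.succ i = D j.castSucc i * Real.exp (-a * y i * h j (x i)) / Z j)
    (_ : ∀ j : Fin t,
      ∑ i, D j.castSucc i * (if h j (x i) = y i then (0 : ℝ) else 1) ≤ 1 / 2 - γ),
    (∀ i, 0 < D (Fin.last t) i) ∧ ∑ i, D (Fin.last t) i = 1 ∧
    ∃ P : ℝ, 0 < P ∧ P ≤ (Real.exp (-a) * (1 / 2 + γ) + Real.exp a * (1 / 2 - γ)) ^ t ∧
      ∀ i, D (Fin.last t) i * P = 1 / m * Real.exp (-a * (y i * ∑ j, h j (x i))) := by
  have hm' : (0 : ℝ) < m := by exact_mod_cast hm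
  have : Nonempty (Fin m) := ⟨⟨0, hm⟩⟩
  induction t with
  | zero =>
    intro h hh D Z hD1 hZ hD herr
    have e : ∀ i, D (Fin.last 0) i = 1 / m := hD1
    refine ⟨fun i => by rw [e]; positivity, ?_, 1, one_pos, by simp, fun i => by rw [e]; simp⟩
    simp only [e]
    simp [hm'.ne']
  | succ t ih =>
    intro h hh D Z hD1 hZ hD herr
    obtain ⟨hpos, hsum, P, hP, hPB, hPe⟩ := ih (fun j => h j.castSucc) (fun j => hh _)
      (fun k => D k.castSucc) (fun j => Z j.castSucc) (fun i => hD1 i)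
      (fun j => hZ _) (fun j i => hD j.castSucc i) (fun j => herr _)
    have hZl := hZ (Fin.last t)
    have hDl := hD (Fin.last t)
    have hel := herr (Fin.last t)
    have hhl := hh (Fin.last t)
    simp only [Fin.succ_last] at hDl
    simp only [Nat.succ_eq_add_one] at hDl
    have hZpos : 0 < Z (Fin.last t) := by
      rw [hZl]
      exact Finset.sum_pos (fun i _ => mul_pos (hpos i) (Real.exp_pos _)) Finset.univ_nonempty
    have hZB : Z (Fin.last t) ≤ Real.exp (-a) * (1 / 2 + γ) + Real.exp a * (1 / 2 - γ) := by
      have key : Z (Fin.last t) = Real.exp (-a) * ∑ i, D (Fin.last t).castSucc i +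
          (Real.exp a - Real.exp (-a)) * ∑ i, D (Fin.last t).castSucc i *
            (if h (Fin.last t) (x i) = y i then (0 : ℝ) else 1) := by
        rw [hZl, Finset.mul_sum, Finset.mul_sum, ← Finset.sum_add_distrib]
        refine Finset.sum_congr rfl fun i _ => ?_
        rcases hy i with h1 | h1 <;> rcases hhl (x i) with h2 | h2 <;> rw [h1, h2] <;>
          norm_num <;> ring
      rw [key, hsum]
      have hlt : 0 < Real.exp a - Real.exp (-a) :=
        sub_pos.2 (Real.exp_lt_exp.2 (by linarith))
      have := mul_le_mul_of_nonneg_left hel hlt.le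
      linarith
    refine ⟨fun i => ?_, ?_, P * Z (Fin.last t), mul_pos hP hZpos, ?_, fun i => ?_⟩
    · rw [hDl]
      exact div_pos (mul_pos (hpos i) (Real.exp_pos _)) hZpos
    · simp only [hDl]
      rw [← Finset.sum_div, ← hZl, div_self hZpos.ne']
    · rw [pow_succ]
      exact mul_le_mul hPB hZB hZpos.le (hP.le.trans hPB)
    · have h1 := hPe i
      rw [hDl, Fin.sum_univ_castSucc, mul_add, mul_add, Real.exp_add,
        ← mul_assoc (1 / (m : ℝ)), ← h1, ← mul_assoc (-a) (y i) (h (Fin.last t) (x i))]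
      field_simp

/-- AdaBoost with the fixed learning rate
α = (1/2)·ln((1+2γ)/(1−2γ)) − (1/2)·ln((1+θ)/(1−θ)) > 0 (0 < γ < 1/2, 0 < θ < 2γ)
in which every round has weighted error at most 1/2 − γ has empirical θ-margin loss of
f = (1/t)·Σ h_j at most (exp((θ−1)α)(1/2+γ) + exp((θ+1)α)(1/2−γ))^t. -/
theorem statement7 {X : Type*} (m t : ℕ) (hm : 0 < m)
    (x : Fin m → X) (y : Fin m → ℝ) (hy : ∀ i, y i = 1 ∨ y i = -1)
    (h : Fin t → X → ℝ) (hh : ∀ j z, h j z = 1 ∨ h j z = -1)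
    (α : Fin t → ℝ) (γ θ a : ℝ)
    (hγ0 : 0 < γ) (hγ : γ < 1 / 2) (hθ0 : 0 < θ) (hθ : θ < 2 * γ)
    (ha : a = (1 / 2) * Real.log ((1 + 2 * γ) / (1 - 2 * γ)) -
      (1 / 2) * Real.log ((1 + θ) / (1 - θ)))
    (hα : ∀ j, α j = a)
    (D : Fin (t + 1) → Fin m → ℝ) (Z : Fin t → ℝ)
    (hD1 : ∀ i, D 0 i = 1 / m)
    (hZ : ∀ j : Fin t, Z j = ∑ i, D j.castSucc i * Real.exp (-(α j) * y i * h j (x i)))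
    (hD : ∀ (j : Fin t) (i),
      D j.succ i = D j.castSucc i * Real.exp (-(α j) * y i * h j (x i)) / Z j)
    (herr : ∀ j : Fin t,
      ∑ i, D j.castSucc i * (if h j (x i) = y i then (0 : ℝ) else 1) ≤ 1 / 2 - γ) :
    0 < a ∧
      (1 / (m : ℝ)) *
          (∑ i, if y i * ((∑ j, h j (x i)) / (t : ℝ)) ≤ θ then (1 : ℝ) else 0) ≤
        (Real.exp ((θ - 1) * a) * (1 / 2 + γ) + Real.exp ((θ + 1) * a) * (1 / 2 - γ)) ^ t := by
  have hapos : 0 < a := by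
    rw [ha]
    have : Real.log ((1 + θ) / (1 - θ)) < Real.log ((1 + 2 * γ) / (1 - 2 * γ)) := by
      apply Real.log_lt_log
      · exact div_pos (by linarith) (by linarith)
      · rw [div_lt_div_iff₀ (by linarith) (by linarith)]
        nlinarith
    linarith
  refine ⟨hapos, ?_⟩
  clear ha
  have hm' : (0 : ℝ) < m := by exact_mod_cast hm
  simp only [hα] at hZ hD
  obtain ⟨hpos, hsum, P, hP, hPB, hPe⟩ := ada_aux m hm x y hy γ a hapos t h hh D Z hD1 hZ hD herr
  have hB : Real.exp ((θ - 1) * a) * (1 / 2 + γ) + Real.exp ((θ + 1) * a) * (1 / 2 - γ) =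
      Real.exp (θ * a) * (Real.exp (-a) * (1 / 2 + γ) + Real.exp a * (1 / 2 - γ)) := by
    rw [show (θ - 1) * a = θ * a + -a by ring, show (θ + 1) * a = θ * a + a by ring,
      Real.exp_add, Real.exp_add]
    ring
  rw [hB, mul_pow]
  have hstep : (1 / (m : ℝ)) *
      (∑ i, if y i * ((∑ j, h j (x i)) / (t : ℝ)) ≤ θ then (1 : ℝ) else 0) ≤
      Real.exp (θ * a) ^ t * P := by
    have : Real.exp (θ * a) ^ t * P = ∑ i, Real.exp (θ * a) ^ t * (D (Fin.last t) i * P) := by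
      rw [← Finset.mul_sum, ← Finset.sum_mul, hsum, one_mul]
    rw [this, Finset.mul_sum]
    refine Finset.sum_le_sum fun i _ => ?_
    rw [hPe i, mul_left_comm]
    refine mul_le_mul_of_nonneg_left ?_ (by positivity)
    rw [← Real.exp_nat_mul, ← Real.exp_add]
    split_ifs with hc
    · rw [Real.one_le_exp_iff]
      have h3 : y i * ∑ j, h j (x i) ≤ θ * t := by
        rcases Nat.eq_zero_or_pos t with h0 | h0
        · subst h0
          simp
        · have h0' : (0 : ℝ) < t := by exact_mod_cast h0
          rwa [← mul_div_assoc, div_le_iff₀ h0'] at hc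
      nlinarith
    · positivity
  exact hstep.trans (mul_le_mul_of_nonneg_left hPB (by positivity))
end

section
/- Under the stated adaptedness and conditional-mean assumptions, for every real t ≤ 0 the moment generating function satisfies ∫_Ω exp( t·Σ_{i=1}^n X_i ) dμ ≤ exp( n·p·(e^t − 1) ). -/
open MeasureTheory

theorem aux_lintegral_update {n : ℕ} (Ω : Fin n → Type*) [∀ i, MeasurableSpace (Ω i)]
    (μ : ∀ i, Measure (Ω i)) [∀ i, IsProbabilityMeasure (μ i)] (i : Fin n)
    (F : (∀ j, Ω j) → ENNReal) (hF : Measurable F) :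
    ∫⁻ ω, F ω ∂(Measure.pi μ) =
      ∫⁻ ω, ∫⁻ u, F (Function.update ω i u) ∂(μ i) ∂(Measure.pi μ) := by
  have hG : Measurable (fun ω : (∀ j, Ω j) => ∫⁻ u, F (Function.update ω i u) ∂(μ i)) := by
    have := hF.lmarginal μ (s := {i})
    simpa only [lmarginal_singleton] using this
  obtain ⟨ω₀⟩ : Nonempty (∀ j, Ω j) := (Measure.pi μ).nonempty_of_neZero
  rw [lintegral_eq_lmarginal_univ ω₀, lintegral_eq_lmarginal_univ ω₀]
  have h1 := lmarginal_erase' (μ := μ) F hF (Finset.mem_univ i)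
  have h2 := lmarginal_erase' (μ := μ) _ hG (Finset.mem_univ i)
  rw [h1, h2]
  simp

open MeasureTheory in
theorem aux_exp (p t : ℝ) (ht : t ≤ 0) {A : Type*} [MeasurableSpace A] (ν : Measure A)
    [IsProbabilityMeasure ν] (Y : A → ℝ) (hY : Measurable Y) (h01 : ∀ u, Y u = 0 ∨ Y u = 1)
    (hm : p ≤ ∫ u, Y u ∂ν) :
    ∫⁻ u, ENNReal.ofReal (Real.exp (t * Y u)) ∂ν ≤
      ENNReal.ofReal (Real.exp (p * (Real.exp t - 1))) := by
  have e : ∀ u, Real.exp (t * Y u) = 1 + Y u * (Real.exp t - 1) := by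
    intro u
    rcases h01 u with h | h <;> simp [h]
  have hi : Integrable Y ν := by
    refine Integrable.of_bound hY.aestronglyMeasurable 1 (Filter.Eventually.of_forall fun u => ?_)
    rcases h01 u with h | h <;> simp [h]
  have hi2 : Integrable (fun u => Y u * (Real.exp t - 1)) ν := hi.mul_const _
  have hi3 : Integrable (fun u => Real.exp (t * Y u)) ν := by
    simp only [e]
    exact (integrable_const 1).add hi2
  rw [← ofReal_integral_eq_lintegral_ofReal hi3
    (Filter.Eventually.of_forall fun u => (Real.exp_pos _).le)]
  apply ENNReal.ofReal_le_ofReal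
  simp only [e]
  rw [integral_add (integrable_const 1) hi2, integral_mul_const]
  have h1 : Real.exp t ≤ 1 := Real.exp_le_one_iff.2 ht
  have h2 := Real.add_one_le_exp (p * (Real.exp t - 1))
  simp
  nlinarith


/-- For {0,1}-valued random variables X_1,…,X_n on a product probability
space, where X_i depends only on the first i coordinates and has conditional mean at
least p given the first i−1 coordinates, the MGF satisfies, for every t ≤ 0,
∫ exp(t·Σ X_i) dμ ≤ exp(n·p·(e^t − 1)). -/
theorem statement11 (n : ℕ) (hn : 0 < n) (p : ℝ) (hp0 : 0 ≤ p) (hp1 : p ≤ 1)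
    (Ω : Fin n → Type*) [∀ i, MeasurableSpace (Ω i)]
    (μ : ∀ i, Measure (Ω i)) [∀ i, IsProbabilityMeasure (μ i)]
    (Xv : Fin n → (∀ j, Ω j) → ℝ)
    (hmeas : ∀ i, Measurable (Xv i))
    (h01 : ∀ i ω, Xv i ω = 0 ∨ Xv i ω = 1)
    (hadapt : ∀ (i : Fin n) (ω ω' : ∀ j, Ω j), (∀ j ≤ i, ω j = ω' j) → Xv i ω = Xv i ω')
    (hmean : ∀ (i : Fin n) (ω : ∀ j, Ω j), p ≤ ∫ u, Xv i (Function.update ω i u) ∂(μ i)) :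
    ∀ t : ℝ, t ≤ 0 →
      ∫ ω, Real.exp (t * ∑ i, Xv i ω) ∂(Measure.pi μ) ≤
        Real.exp ((n : ℝ) * p * (Real.exp t - 1)) := by
  intro t ht
  have key : ∀ s : Finset (Fin n),
      ∫⁻ ω, ENNReal.ofReal (Real.exp (t * ∑ i ∈ s, Xv i ω)) ∂(Measure.pi μ) ≤
        ENNReal.ofReal (Real.exp ((s.card : ℝ) * (p * (Real.exp t - 1)))) := by
    intro s
    induction s using Finset.induction_on_max with
    | empty => simp
    | insert a s ha ih =>
      have has : a ∉ s := fun h => lt_irrefl _ (ha a h)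
      have hms : Measurable (fun ω => ∑ i ∈ s, Xv i ω) :=
        Finset.measurable_fun_sum _ fun i _ => hmeas i
      have hm2 : Measurable (fun ω => ∑ i ∈ insert a s, Xv i ω) :=
        Finset.measurable_fun_sum _ fun i _ => hmeas i
      rw [aux_lintegral_update Ω μ a _ (by fun_prop)]
      have hpt : ∀ ω, ∫⁻ u, ENNReal.ofReal
          (Real.exp (t * ∑ i ∈ insert a s, Xv i (Function.update ω a u))) ∂(μ a) ≤
          ENNReal.ofReal (Real.exp (t * ∑ i ∈ s, Xv i ω)) *
            ENNReal.ofReal (Real.exp (p * (Real.exp t - 1))) := by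
        intro ω
        have hY : Measurable (fun u => Xv a (Function.update ω a u)) :=
          (hmeas a).comp (measurable_update ω)
        have e : ∀ u, ENNReal.ofReal
            (Real.exp (t * ∑ i ∈ insert a s, Xv i (Function.update ω a u))) =
            ENNReal.ofReal (Real.exp (t * ∑ i ∈ s, Xv i ω)) *
            ENNReal.ofReal (Real.exp (t * Xv a (Function.update ω a u))) := by
          intro u
          have : ∑ i ∈ s, Xv i (Function.update ω a u) = ∑ i ∈ s, Xv i ω := by
            refine Finset.sum_congr rfl fun i hi => hadapt i _ _ fun j hj => ?_
            exact Function.update_of_ne (lt_of_le_of_lt hj (ha i hi)).ne _ _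
          rw [Finset.sum_insert has, this, ← ENNReal.ofReal_mul (Real.exp_pos _).le,
            ← Real.exp_add]
          congr 2
          ring
        simp only [e]
        rw [lintegral_const_mul _ (by fun_prop)]
        gcongr
        exact aux_exp p t ht (μ a) _ hY (fun u => h01 a _) (hmean a ω)
      refine (lintegral_mono hpt).trans ?_
      rw [lintegral_mul_const _ (by fun_prop)]
      refine (mul_le_mul_left ih _).trans (le_of_eq ?_)
      rw [← ENNReal.ofReal_mul (Real.exp_pos _).le, ← Real.exp_add,
        Finset.card_insert_of_notMem has]
      congr 2
      push_cast
      ring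
  have hms : Measurable (fun ω => ∑ i, Xv i ω) :=
    Finset.measurable_fun_sum _ fun i _ => hmeas i
  rw [integral_eq_lintegral_of_nonneg_ae
    (Filter.Eventually.of_forall fun u => (Real.exp_pos _).le)
    (by fun_prop)]
  refine ENNReal.toReal_le_of_le_ofReal (Real.exp_pos _).le ((key Finset.univ).trans ?_)
  rw [Finset.card_univ, Fintype.card_fin, mul_assoc]
end

section
/- Under the stated adaptedness and conditional-mean assumptions, for every ρ ∈ (0,1) the lower tail satisfies μ( { ω ∈ Ω : Σ_{i=1}^n X_i(ω) < (1−ρ)·n·p } ) ≤ ( exp(−ρ) / (1−ρ)^{1−ρ} )^{n·p}. -/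
open MeasureTheory

lemma step_aux (n : ℕ) (p : ℝ)
    (Ω : Fin n → Type*) [∀ i, MeasurableSpace (Ω i)]
    (μ : ∀ i, Measure (Ω i)) [∀ i, IsProbabilityMeasure (μ i)]
    (Xv : Fin n → (∀ j, Ω j) → ℝ)
    (hmeas : ∀ i, Measurable (Xv i))
    (h01 : ∀ i ω, Xv i ω = 0 ∨ Xv i ω = 1)
    (hadapt : ∀ (i : Fin n) (ω ω' : ∀ j, Ω j), (∀ j ≤ i, ω j = ω' j) → Xv i ω = Xv i ω')
    (hmean : ∀ (i : Fin n) (ω : ∀ j, Ω j), p ≤ ∫ u, Xv i (Function.update ω i u) ∂(μ i))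
    (ρ : ℝ) (h0 : 0 < ρ) (h1 : ρ < 1) (k : ℕ) (hk : k ≤ n) :
    ∫⁻ ω, ∏ i ∈ Finset.univ.filter (fun i : Fin n => i.val < k),
      ENNReal.ofReal (1 - ρ * Xv i ω) ∂(Measure.pi μ) ≤ (ENNReal.ofReal (1 - ρ * p)) ^ k := by
  have hgm : ∀ i, Measurable (fun ω => ENNReal.ofReal (1 - ρ * Xv i ω)) := fun i =>
    ((hmeas i).const_mul ρ |>.const_sub 1).ennreal_ofReal
  induction k with
  | zero => simp
  | succ k ih =>
    have ih := ih (by omega)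
    let K : Fin n := ⟨k, by omega⟩
    have hf : Finset.univ.filter (fun i : Fin n => i.val < k + 1)
        = insert K (Finset.univ.filter (fun i : Fin n => i.val < k)) := by
      ext i
      simp [K, Fin.ext_iff]
      omega
    have hK : K ∉ Finset.univ.filter (fun i : Fin n => i.val < k) := by simp [K]
    have hPm : Measurable (fun ω => ∏ i ∈ Finset.univ.filter (fun i : Fin n => i.val < k),
        ENNReal.ofReal (1 - ρ * Xv i ω)) := Finset.measurable_fun_prod _ (fun i _ => hgm i)
    have hconst : ∀ (ω : ∀ j, Ω j) (u : Ω K),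
        ∏ i ∈ Finset.univ.filter (fun i : Fin n => i.val < k),
          ENNReal.ofReal (1 - ρ * Xv i (Function.update ω K u)) =
        ∏ i ∈ Finset.univ.filter (fun i : Fin n => i.val < k),
          ENNReal.ofReal (1 - ρ * Xv i ω) := by
      intro ω u
      refine Finset.prod_congr rfl fun i hi => ?_
      rw [hadapt i (Function.update ω K u) ω]
      intro j hj
      rw [Function.update_of_ne]
      rintro rfl
      simp at hi
      have : k ≤ i.val := hj
      omega
    have key : ∀ ω : ∀ j, Ω j,
        ∫⁻ u, ENNReal.ofReal (1 - ρ * Xv K (Function.update ω K u)) ∂(μ K)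
          ≤ ENNReal.ofReal (1 - ρ * p) := by
      intro ω
      have hm : Measurable (fun u => Xv K (Function.update ω K u)) :=
        (hmeas K).comp (measurable_update ω)
      have hi : Integrable (fun u => Xv K (Function.update ω K u)) (μ K) := by
        refine Integrable.of_bound hm.aestronglyMeasurable 1 (Filter.Eventually.of_forall ?_)
        intro u
        rcases h01 K (Function.update ω K u) with h | h <;> simp [h]
      rw [← ofReal_integral_eq_lintegral_ofReal]
      · apply ENNReal.ofReal_le_ofReal
        rw [integral_sub (integrable_const _) (hi.const_mul ρ), integral_const_mul]
        have := hmean K ω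
        have h2 := mul_le_mul_of_nonneg_left this h0.le
        simp only [integral_const, probReal_univ, smul_eq_mul, one_mul]
        linarith
      · exact (integrable_const _).sub (hi.const_mul ρ)
      · refine Filter.Eventually.of_forall fun u => ?_
        rcases h01 K (Function.update ω K u) with h | h <;> simp [h]
        exact h1.le
    have hle := lintegral_le_of_lmarginal_le (μ := μ) {K}
      (f := fun ω => ∏ i ∈ Finset.univ.filter (fun i : Fin n => i.val < k + 1),
          ENNReal.ofReal (1 - ρ * Xv i ω))
      (g := fun ω => ENNReal.ofReal (1 - ρ * p) *
        ∏ i ∈ Finset.univ.filter (fun i : Fin n => i.val < k), ENNReal.ofReal (1 - ρ * Xv i ω))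
      (Finset.measurable_fun_prod _ (fun i _ => hgm i)) (hPm.const_mul _) (by
        intro ω
        rw [lmarginal_singleton, lmarginal_singleton]
        simp only [hf, Finset.prod_insert hK, hconst]
        have hm : Measurable (fun u => ENNReal.ofReal (1 - ρ * Xv K (Function.update ω K u))) :=
          (hgm K).comp (measurable_update ω)
        rw [lintegral_mul_const _ hm]
        simp only [lintegral_const, measure_univ, mul_one]
        gcongr
        exact key ω)
    refine hle.trans ?_
    rw [lintegral_const_mul _ hPm, pow_succ']
    gcongr

/-- For {0,1}-valued random variables X_1,…,X_n on a product probability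
space, where X_i depends only on the first i coordinates and has conditional mean at
least p given the first i−1 coordinates, the lower tail satisfies, for every ρ ∈ (0,1),
μ(Σ X_i < (1−ρ)·n·p) ≤ (exp(−ρ)/(1−ρ)^{1−ρ})^{n·p}. -/
theorem statement12 (n : ℕ) (hn : 0 < n) (p : ℝ) (hp0 : 0 ≤ p) (hp1 : p ≤ 1)
    (Ω : Fin n → Type*) [∀ i, MeasurableSpace (Ω i)]
    (μ : ∀ i, Measure (Ω i)) [∀ i, IsProbabilityMeasure (μ i)]
    (Xv : Fin n → (∀ j, Ω j) → ℝ)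
    (hmeas : ∀ i, Measurable (Xv i))
    (h01 : ∀ i ω, Xv i ω = 0 ∨ Xv i ω = 1)
    (hadapt : ∀ (i : Fin n) (ω ω' : ∀ j, Ω j), (∀ j ≤ i, ω j = ω' j) → Xv i ω = Xv i ω')
    (hmean : ∀ (i : Fin n) (ω : ∀ j, Ω j), p ≤ ∫ u, Xv i (Function.update ω i u) ∂(μ i)) :
    ∀ ρ : ℝ, 0 < ρ → ρ < 1 →
      Measure.pi μ {ω | ∑ i, Xv i ω < (1 - ρ) * (n : ℝ) * p} ≤
        ENNReal.ofReal ((Real.exp (-ρ) / (1 - ρ) ^ ((1 : ℝ) - ρ)) ^ ((n : ℝ) * p)) := by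
  intro ρ h0 h1
  have ht : 0 < 1 - ρ := by linarith
  have hE := step_aux n p Ω μ Xv hmeas h01 hadapt hmean ρ h0 h1 n le_rfl
  have huniv : Finset.univ.filter (fun i : Fin n => i.val < n) = Finset.univ := by
    ext i; simp
  rw [huniv] at hE
  have hgm : ∀ i, Measurable (fun ω => ENNReal.ofReal (1 - ρ * Xv i ω)) := fun i =>
    ((hmeas i).const_mul ρ |>.const_sub 1).ennreal_ofReal
  have hpow : ∀ i ω, 1 - ρ * Xv i ω = (1 - ρ) ^ (Xv i ω) := by
    intro i ω
    rcases h01 i ω with h | h <;> simp [h]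
  set a : ℝ := (1 - ρ) ^ ((1 - ρ) * (n : ℝ) * p) with ha
  have hapos : 0 < a := Real.rpow_pos_of_pos ht _
  have hsub : {ω | ∑ i, Xv i ω < (1 - ρ) * (n : ℝ) * p} ⊆
      {ω | ENNReal.ofReal a ≤ ∏ i, ENNReal.ofReal (1 - ρ * Xv i ω)} := by
    intro ω hω
    simp only [Set.mem_setOf_eq] at hω ⊢
    rw [← ENNReal.ofReal_prod_of_nonneg (fun i _ => by
      rw [hpow]; exact (Real.rpow_pos_of_pos ht _).le)]
    apply ENNReal.ofReal_le_ofReal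
    simp only [hpow]
    rw [← Real.rpow_sum_of_pos ht]
    exact Real.rpow_le_rpow_of_exponent_ge ht (by linarith) hω.le
  have hmk := meas_ge_le_lintegral_div (μ := Measure.pi μ)
    (f := fun ω => ∏ i, ENNReal.ofReal (1 - ρ * Xv i ω))
    (Finset.measurable_fun_prod _ (fun i _ => hgm i)).aemeasurable
    (ε := ENNReal.ofReal a) (by simpa using hapos) ENNReal.ofReal_ne_top
  refine (measure_mono hsub).trans (hmk.trans ?_)
  have hq : 0 ≤ 1 - ρ * p := by nlinarith
  have hfin : (1 - ρ * p) ^ n / a ≤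
      (Real.exp (-ρ) / (1 - ρ) ^ ((1 : ℝ) - ρ)) ^ ((n : ℝ) * p) := by
    rw [Real.div_rpow (Real.exp_pos _).le (Real.rpow_pos_of_pos ht _).le,
      ← Real.rpow_mul ht.le, ← mul_assoc, ← ha, ← Real.exp_mul]
    gcongr
    calc (1 - ρ * p) ^ n ≤ (Real.exp (-(ρ * p))) ^ n := by
          gcongr
          exact Real.one_sub_le_exp_neg _
      _ = _ := by
          rw [← Real.exp_nat_mul]
          congr 1
          ring
  refine le_trans ?_ (ENNReal.ofReal_le_ofReal hfin)
  rw [ENNReal.ofReal_div_of_pos hapos, ENNReal.ofReal_pow hq]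
  gcongr
end

section
/- Assume m ≥ 2200. For every integer t ≥ 1 and all indices r_1,…,r_t ∈ {1,…,m−1}, the vector w' = −Σ_{q=1}^t x_{r_q} + t·x_m ∈ ℝ³ satisfies ⟨w', x_i⟩ > 0 for every i ∈ {1,…,m−1} and ⟨w', x_m⟩ > 0; in particular the halfspace classifier sign⟨w',·⟩ misclassifies every negatively labeled point x_i (i ≤ m−1) and correctly classifies x_m. -/
noncomputable section

/-- Euclidean inner product on ℝ³. -/
def dot3 (v w : Fin 3 → ℝ) : ℝ := ∑ j, v j * w j

/-- The labeled points: x_i = (0, 1 − i/m⁴, 1) for 1 ≤ i ≤ m−1 and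
x_m = (√(1/m), 1, 1). -/
def ptx (m i : ℕ) : Fin 3 → ℝ :=
  if i = m then ![Real.sqrt (1 / m), 1, 1] else ![0, 1 - (i : ℝ) / (m : ℝ) ^ 4, 1]

/-- For m ≥ 2200, t ≥ 1 and r_1,…,r_t ∈ {1,…,m−1}, the vector
w' = −Σ_q x_{r_q} + t·x_m has ⟨w', x_i⟩ > 0 for all i ∈ {1,…,m−1} and ⟨w', x_m⟩ > 0. -/
theorem statement13 (m : ℕ) (hm : 2200 ≤ m) (t : ℕ) (ht : 1 ≤ t)
    (r : Fin t → ℕ) (hr : ∀ q, 1 ≤ r q ∧ r q ≤ m - 1) :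
    (∀ i : ℕ, 1 ≤ i → i ≤ m - 1 →
        0 < dot3 (fun j => -(∑ q, ptx m (r q) j) + (t : ℝ) * ptx m m j) (ptx m i)) ∧
      0 < dot3 (fun j => -(∑ q, ptx m (r q) j) + (t : ℝ) * ptx m m j) (ptx m m) := by
  have hmR : (2200 : ℝ) ≤ (m : ℝ) := by exact_mod_cast hm
  have hm4 : (0 : ℝ) < (m : ℝ) ^ 4 := by positivity
  have htR : (1 : ℝ) ≤ (t : ℝ) := by exact_mod_cast ht
  have hne : ∀ i : ℕ, i ≤ m - 1 → i ≠ m := fun i hi => by omega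
  have hp : ∀ q, ptx m (r q) = ![0, 1 - (r q : ℝ) / (m : ℝ) ^ 4, 1] := fun q => by
    simp only [ptx, if_neg (hne _ (hr q).2)]
  have hpm : ptx m m = ![Real.sqrt (1 / m), 1, 1] := by simp only [ptx, if_true]
  have hs : 0 < Real.sqrt (1 / (m : ℝ)) := Real.sqrt_pos.mpr (by positivity)
  have hS : 0 < ∑ q, (r q : ℝ) / (m : ℝ) ^ 4 := by
    apply Finset.sum_pos
    · intro q _
      have : (1 : ℝ) ≤ (r q : ℝ) := by exact_mod_cast (hr q).1
      positivity
    · exact ⟨⟨0, ht⟩, Finset.mem_univ _⟩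
  have key : ∀ v : Fin 3 → ℝ,
      dot3 (fun j => -(∑ q, ptx m (r q) j) + (t : ℝ) * ptx m m j) v
        = t * Real.sqrt (1 / (m : ℝ)) * v 0 + (∑ q, (r q : ℝ) / (m : ℝ) ^ 4) * v 1 := by
    intro v
    simp only [dot3, Fin.sum_univ_three, hp, hpm]
    simp [Finset.sum_sub_distrib]
  refine ⟨fun i _ hi => ?_, ?_⟩
  · rw [key]
    have hlt : (i : ℝ) / (m : ℝ) ^ 4 < 1 := by
      rw [div_lt_one hm4]
      have h1 : (i : ℝ) < m := by exact_mod_cast (by omega : i < m)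
      have h2 : (m : ℝ) ≤ (m : ℝ) ^ 4 := le_self_pow₀ (by linarith) (by norm_num)
      linarith
    have h0 : ptx m i 0 = 0 := by simp [ptx, if_neg (hne i hi)]
    have h1 : ptx m i 1 = 1 - (i : ℝ) / (m : ℝ) ^ 4 := by simp [ptx, if_neg (hne i hi)]
    rw [h0, h1, mul_zero, zero_add]
    exact mul_pos hS (by linarith)
  · rw [key]
    have h0 : ptx m m 0 = Real.sqrt (1 / (m : ℝ)) := by rw [hpm]; rfl
    have h1 : ptx m m 1 = 1 := by rw [hpm]; rfl
    rw [h0, h1]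
    have : 0 < (t : ℝ) := by linarith
    positivity

end
end

section
/- Assume m ≥ 2200. For every integer t with 0 ≤ t ≤ 2m−2 and all indices r_1,…,r_{t+1} ∈ {1,…,m−1}, the vector w' = −Σ_{q=1}^{t+1} x_{r_q} + t·x_m ∈ ℝ³ satisfies ⟨w', x_i⟩ < 0 for every i ∈ {1,…,m−1} and ⟨w', x_m⟩ < 0; in particular the halfspace classifier sign⟨w',·⟩ correctly classifies every negatively labeled point x_i (i ≤ m−1) and misclassifies x_m. -/
noncomputable section

/-- For m ≥ 2200, 0 ≤ t ≤ 2m−2 and r_1,…,r_{t+1} ∈ {1,…,m−1}, the vector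
w' = −Σ_{q=1}^{t+1} x_{r_q} + t·x_m has ⟨w', x_i⟩ < 0 for all i ∈ {1,…,m−1} and
⟨w', x_m⟩ < 0. -/
theorem statement14 (m : ℕ) (hm : 2200 ≤ m) (t : ℕ) (ht : t ≤ 2 * m - 2)
    (r : Fin (t + 1) → ℕ) (hr : ∀ q, 1 ≤ r q ∧ r q ≤ m - 1) :
    (∀ i : ℕ, 1 ≤ i → i ≤ m - 1 →
        dot3 (fun j => -(∑ q, ptx m (r q) j) + (t : ℝ) * ptx m m j) (ptx m i) < 0) ∧
      dot3 (fun j => -(∑ q, ptx m (r q) j) + (t : ℝ) * ptx m m j) (ptx m m) < 0 := by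
  have hM : (2200:ℝ) ≤ m := by exact_mod_cast hm
  have hM0 : (0:ℝ) < m := by linarith
  have hT : (t:ℝ) ≤ 2 * m - 2 := by
    have h : t + 2 ≤ 2 * m := by omega
    have h' : (t:ℝ) + 2 ≤ 2 * m := by exact_mod_cast h
    linarith
  have hp : ∀ i : ℕ, i ≤ m - 1 → ptx m i = ![0, 1 - (i : ℝ) / (m : ℝ) ^ 4, 1] := by
    intro i hi
    have : i ≠ m := by omega
    simp [ptx, this]
  have hpm : ptx m m = ![Real.sqrt (1 / m), 1, 1] := by simp [ptx]
  have hs : Real.sqrt (1 / m) * Real.sqrt (1 / m) = 1 / m :=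
    Real.mul_self_sqrt (by positivity)
  obtain ⟨S, hS⟩ : ∃ S : ℝ, S = ∑ q, (r q : ℝ) / (m : ℝ) ^ 4 := ⟨_, rfl⟩
  have hSle : S ≤ 2 * m * (m / (m : ℝ) ^ 4) := by
    have h1 : S ≤ ∑ _q : Fin (t + 1), (m : ℝ) / (m : ℝ) ^ 4 := by
      rw [hS]
      refine Finset.sum_le_sum fun q _ => ?_
      have h2 : r q ≤ m := by have := (hr q).2; omega
      have h3 : (r q : ℝ) ≤ m := by exact_mod_cast h2
      gcongr
    simp only [Finset.sum_const, Finset.card_univ, Fintype.card_fin, nsmul_eq_mul] at h1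
    refine h1.trans ?_
    push_cast
    gcongr
    linarith
  have hSm : S * m < 2 := by
    have h1 : 2 * m * (m / (m : ℝ) ^ 4) = 2 / (m : ℝ) ^ 2 := by field_simp
    rw [h1, le_div_iff₀ (by positivity)] at hSle
    by_contra! h
    nlinarith
  have hS1 : S < 1 := by
    by_contra! h
    nlinarith
  have e0 : ∑ q, ptx m (r q) 0 = 0 :=
    Finset.sum_eq_zero fun q _ => by rw [hp _ (hr q).2]; simp
  have e1 : ∑ q, ptx m (r q) 1 = (t + 1) - S := by
    have : ∀ q, ptx m (r q) 1 = 1 - (r q : ℝ) / (m : ℝ) ^ 4 := fun q => by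
      rw [hp _ (hr q).2]; simp
    simp only [this, Finset.sum_sub_distrib, ← hS]
    simp
  have e2 : ∑ q, ptx m (r q) 2 = t + 1 := by
    have : ∀ q, ptx m (r q) 2 = 1 := fun q => by
      rw [hp _ (hr q).2]; simp
    simp [this]
  constructor
  · intro i _ hi
    have hi1 : (i : ℝ) / (m : ℝ) ^ 4 ≤ 1 := by
      rw [div_le_one (by positivity)]
      have h2 : i ≤ m ^ 4 := le_trans (by omega) (Nat.le_self_pow (by norm_num) m)
      exact_mod_cast h2
    simp only [dot3, Fin.sum_univ_three, e0, e1, e2, hpm, hp i hi]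
    simp only [Matrix.cons_val]
    nlinarith [mul_nonneg (sub_nonneg.2 hS1.le) (sub_nonneg.2 hi1)]
  · simp only [dot3, Fin.sum_univ_three, e0, e1, e2, hpm]
    simp only [Matrix.cons_val]
    have h1 : (t : ℝ) * (1 / m) + S < 2 := by
      have : (t : ℝ) * (1 / m) + S = (t + S * m) / m := by field_simp
      rw [this, div_lt_iff₀ hM0]
      linarith
    have h2 : (t : ℝ) * (Real.sqrt (1 / m) * Real.sqrt (1 / m)) = t * (1 / m) := by rw [hs]
    linarith

end
end

section
/- Assume m ≥ 10. The vector w = (1, −√(1/(2m)), 0) ∈ ℝ³ satisfies ⟨w, x_i⟩ < −√(1/(4m)) for every i ∈ {1,…,m−1}, ⟨w, x_m⟩ ≥ √(1/(16m)), and ‖w‖₂ ≤ 2; consequently the margin of the labeled data set satisfies sup_{v ∈ ℝ³, ‖v‖₂ ≤ 1} min_{j ∈ {1,…,m}} y_j·⟨v, x_j⟩ ≥ √(1/(64m)). -/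
noncomputable section

/-- Euclidean norm on ℝ³. -/
def norm3 (v : Fin 3 → ℝ) : ℝ := Real.sqrt (dot3 v v)

/-- The labels: y_i = −1 for i ≤ m−1 and y_m = 1. -/
def lab (m i : ℕ) : ℝ := if i = m then 1 else -1

/-- Scaling facts for the square roots. -/
theorem sqrt_facts (m : ℕ) (hm : 10 ≤ m) : ∃ s a : ℝ, 0 < s ∧ s ≤ 1 ∧ 0.7 ≤ a ∧ a ≤ 0.71 ∧
    Real.sqrt (1 / m) = s ∧ Real.sqrt (1 / (2 * m)) = a * s ∧ Real.sqrt (1 / (4 * m)) = s / 2 ∧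
    Real.sqrt (1 / (16 * m)) = s / 4 ∧ Real.sqrt (1 / (64 * m)) = s / 8 := by
  have hm' : (10 : ℝ) ≤ m := by exact_mod_cast hm
  have hp : (0 : ℝ) < 1 / m := by positivity
  have hs := Real.sq_sqrt hp.le
  have hs0 := Real.sqrt_pos.2 hp
  refine ⟨Real.sqrt (1 / m), Real.sqrt (1 / 2), hs0, ?_, ?_, ?_, rfl, ?_, ?_, ?_, ?_⟩
  · rw [Real.sqrt_le_left (by norm_num), one_pow, div_le_one (by linarith)]
    linarith
  · apply Real.le_sqrt_of_sq_le; norm_num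
  · rw [Real.sqrt_le_left (by norm_num)]; norm_num
  · rw [← Real.sqrt_mul (by norm_num)]
    congr 1
    field_simp
  all_goals
    rw [Real.sqrt_eq_iff_mul_self_eq_of_pos (by positivity)]
    rw [← pow_two, div_pow, hs]
    field_simp
    norm_num

theorem part_one (m : ℕ) (hm : 10 ≤ m) (i : ℕ) (hi : i ≤ m - 1) :
    dot3 ![1, -Real.sqrt (1 / (2 * m)), 0] (ptx m i) < -Real.sqrt (1 / (4 * m)) := by
  obtain ⟨s, a, h0, h1, h2, h3, e1, e2, e3, e4, e5⟩ := sqrt_facts m hm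
  have hne : i ≠ m := by omega
  have hm' : (10 : ℝ) ≤ m := by exact_mod_cast hm
  have him : (i : ℝ) ≤ m := by exact_mod_cast (by omega : i ≤ m)
  have hq : (i : ℝ) / (m : ℝ) ^ 4 ≤ 0.1 := by
    rw [div_le_iff₀ (by positivity)]
    have : (10 : ℝ) ^ 3 ≤ (m : ℝ) ^ 3 := by gcongr
    nlinarith
  rw [e2, e3]
  simp only [dot3, ptx, if_neg hne, Fin.sum_univ_three]
  simp
  have : 0.63 ≤ a * (1 - (i : ℝ) / (m : ℝ) ^ 4) := by nlinarith
  nlinarith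

theorem part_two (m : ℕ) (hm : 10 ≤ m) :
    Real.sqrt (1 / (16 * m)) ≤ dot3 ![1, -Real.sqrt (1 / (2 * m)), 0] (ptx m m) := by
  obtain ⟨s, a, h0, h1, h2, h3, e1, e2, e3, e4, e5⟩ := sqrt_facts m hm
  rw [e2, e4]
  simp only [dot3, ptx, if_true, Fin.sum_univ_three, e1]
  simp
  nlinarith

theorem part_three (m : ℕ) (hm : 10 ≤ m) :
    norm3 ![1, -Real.sqrt (1 / (2 * m)), 0] ≤ 2 := by
  obtain ⟨s, a, h0, h1, h2, h3, e1, e2, e3, e4, e5⟩ := sqrt_facts m hm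
  rw [e2, norm3, Real.sqrt_le_left (by norm_num)]
  simp only [dot3, Fin.sum_univ_three]
  simp
  have : a * s ≤ 1 := by nlinarith
  have : 0 ≤ a * s := by nlinarith
  nlinarith

theorem dot3_smul (c : ℝ) (v x : Fin 3 → ℝ) : dot3 (c • v) x = c * dot3 v x := by
  simp only [dot3, Fin.sum_univ_three, Pi.smul_apply, smul_eq_mul]
  ring

theorem norm3_half (v : Fin 3 → ℝ) (h : norm3 v ≤ 2) : norm3 ((1 / 2 : ℝ) • v) ≤ 1 := by
  rw [norm3, Real.sqrt_le_left (by norm_num)] at *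
  simp only [dot3, Fin.sum_univ_three, Pi.smul_apply, smul_eq_mul] at *
  nlinarith

theorem dot3_last_le (m : ℕ) (hm : 10 ≤ m) (v : Fin 3 → ℝ) (hv : norm3 v ≤ 1) :
    dot3 v (ptx m m) ≤ 3 := by
  obtain ⟨s, a, h0, h1, h2, h3, e1, e2, e3, e4, e5⟩ := sqrt_facts m hm
  rw [norm3, Real.sqrt_le_left (by norm_num)] at hv
  simp only [dot3, ptx, if_true, Fin.sum_univ_three, e1] at *
  simp
  nlinarith [sq_nonneg (v 0 - s), sq_nonneg (v 1 - 1), sq_nonneg (v 2 - 1)]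

/-- For m ≥ 10, w = (1, −√(1/(2m)), 0) satisfies ⟨w,x_i⟩ < −√(1/(4m)) for
1 ≤ i ≤ m−1, ⟨w,x_m⟩ ≥ √(1/(16m)) and ‖w‖₂ ≤ 2; consequently the margin satisfies
sup_{‖v‖₂ ≤ 1} min_{1 ≤ j ≤ m} y_j·⟨v,x_j⟩ ≥ √(1/(64m)). -/
theorem statement15 (m : ℕ) (hm : 10 ≤ m) :
    (∀ i : ℕ, 1 ≤ i → i ≤ m - 1 →
        dot3 ![1, -Real.sqrt (1 / (2 * m)), 0] (ptx m i) < -Real.sqrt (1 / (4 * m))) ∧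
      Real.sqrt (1 / (16 * m)) ≤ dot3 ![1, -Real.sqrt (1 / (2 * m)), 0] (ptx m m) ∧
      norm3 ![1, -Real.sqrt (1 / (2 * m)), 0] ≤ 2 ∧
      Real.sqrt (1 / (64 * m)) ≤
        ⨆ v : {v : Fin 3 → ℝ // norm3 v ≤ 1},
          ⨅ j : Fin m, lab m ((j : ℕ) + 1) * dot3 v.1 (ptx m ((j : ℕ) + 1)) := by
  refine ⟨fun i _ hi => part_one m hm i hi, part_two m hm, part_three m hm, ?_⟩
  have : Nonempty (Fin m) := ⟨⟨0, by omega⟩⟩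
  obtain ⟨s, a, h0, h1, h2, h3, e1, e2, e3, e4, e5⟩ := sqrt_facts m hm
  have hb : BddAbove (Set.range fun v : {v : Fin 3 → ℝ // norm3 v ≤ 1} =>
      ⨅ j : Fin m, lab m ((j : ℕ) + 1) * dot3 v.1 (ptx m ((j : ℕ) + 1))) := by
    refine ⟨3, ?_⟩
    rintro _ ⟨v, rfl⟩
    refine (ciInf_le (Set.finite_range _).bddBelow (⟨m - 1, by omega⟩ : Fin m)).trans ?_
    have hmm : m - 1 + 1 = m := by omega
    simp only [hmm, lab, if_true, one_mul]
    exact dot3_last_le m hm v.1 v.2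
  refine le_trans ?_ (le_ciSup hb ⟨_, norm3_half _ (part_three m hm)⟩)
  refine le_ciInf fun j => ?_
  simp only [dot3_smul]
  by_cases hj : (j : ℕ) + 1 = m
  · have := part_two m hm
    rw [hj]
    simp only [lab, if_true]
    rw [e4] at this
    rw [e5]
    linarith
  · have := part_one m hm (j + 1) (by omega)
    simp only [lab, if_neg hj]
    rw [e3] at this
    rw [e5]
    linarith

end
end
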